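/- arXiv:2412.07936 — 3 statements merged into one kernel-verified Lean document; each statement's English description precedes it below -/
import Mathlib

section
/- Let x_1, ..., x_n be independent real-valued random variables with E[x_j] = 0 for all j, and let {B_i}_{i ∈ T^d_n} be a family of deterministic real matrices of a common dimension indexed by d-tuples of distinct indices. Then for every 1 ≤ t < ∞, E ‖Σ_{i ∈ T^d_n} B_i · x_{i_1} ⋯ x_{i_d}‖_{2t} ≤ d^d · E ‖Σ_{i ∈ T^d_n} B_i · x^{(1)}_{i_1} ⋯ x^{(d)}_{i_d}‖_{2t}, where x^{(1)}, ..., x^{(d)} are d independent copies of the sequence x = (x_1,...,x_n). -/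
open MeasureTheory ProbabilityTheory Matrix
open scoped BigOperators ENNReal

/-- Entrywise expectation of a random matrix. -/
noncomputable def matIntegral {Ω : Type*} [MeasurableSpace Ω] (μ : Measure Ω)
    {R C : Type*} (M : Ω → Matrix R C ℝ) : Matrix R C ℝ :=
  Matrix.of fun i j => ∫ ω, M ω i j ∂μ

/-- `schattenPow t A = tr ((AᴴA)^t) = ‖A‖_{2t}^{2t}`, the `2t`-th power of the Schatten
`2t`-norm of a real matrix `A`, defined for a real exponent `t` via the eigenvalues of
the Hermitian matrix `AᴴA`. -/
noncomputable def schattenPow {R C : Type*} [Fintype R] [Fintype C] [DecidableEq C]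
    (t : ℝ) (A : Matrix R C ℝ) : ℝ :=
  ∑ i, (Matrix.isHermitian_conjTranspose_mul_self A).eigenvalues i ^ t

/-- The Schatten `2t`-norm of a real matrix: `‖A‖_{2t} = (tr ((AᴴA)^t))^(1/(2t))`. -/
noncomputable def schattenNorm {R C : Type*} [Fintype R] [Fintype C] [DecidableEq C]
    (t : ℝ) (A : Matrix R C ℝ) : ℝ :=
  schattenPow t A ^ (2 * t)⁻¹

lemma sch_sq {R C : Type*} [Fintype R] [Fintype C] [DecidableEq C] (A : Matrix R C ℝ)
    (u : EuclideanSpace ℝ C) :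
    ‖toEuclideanLin A u‖ ^ 2 = ∑ k, (inner ℝ ((isHermitian_conjTranspose_mul_self A).eigenvectorBasis k) u) ^ 2
      * (isHermitian_conjTranspose_mul_self A).eigenvalues k := by
  classical
  set hA := isHermitian_conjTranspose_mul_self A
  have hM : ∀ v w : EuclideanSpace ℝ C, inner ℝ (toEuclideanLin (Aᴴ * A) v) w
      = inner ℝ (toEuclideanLin A v) (toEuclideanLin A w) := by
    intro v w
    rw [toLpLin_mul_same, toEuclideanLin_conjTranspose_eq_adjoint, LinearMap.comp_apply,
      LinearMap.adjoint_inner_left]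
  rw [← real_inner_self_eq_norm_sq, ← hM, ← hA.eigenvectorBasis.sum_inner_mul_inner]
  refine Finset.sum_congr rfl fun k _ => ?_
  rw [hM, real_inner_comm, ← hM, real_inner_comm]
  have : toEuclideanLin (Aᴴ * A) (hA.eigenvectorBasis k)
      = hA.eigenvalues k • hA.eigenvectorBasis k := by
    rw [toLpLin_apply, hA.mulVec_eigenvectorBasis]
    rfl
  rw [real_inner_comm (toEuclideanLin (Aᴴ * A) (hA.eigenvectorBasis k)), this, inner_smul_left]
  simp
  ring

lemma sch_eig_nonneg {R C : Type*} [Fintype R] [Fintype C] [DecidableEq C] (A : Matrix R C ℝ) (k : C) :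
    0 ≤ (isHermitian_conjTranspose_mul_self A).eigenvalues k :=
  (posSemidef_conjTranspose_mul_self A).eigenvalues_nonneg k

lemma sch_le {R C : Type*} [Fintype R] [Fintype C] [DecidableEq C] (A : Matrix R C ℝ)
    (u : OrthonormalBasis C ℝ (EuclideanSpace ℝ C)) {t : ℝ} (ht : 1 ≤ t) :
    (∑ i, ‖toEuclideanLin A (u i)‖ ^ (2 * t)) ^ (1 / (2 * t)) ≤ schattenNorm t A := by
  rw [schattenNorm, one_div]
  refine Real.rpow_le_rpow (Finset.sum_nonneg fun i _ => by positivity) ?_ (by positivity)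
  rw [schattenPow]
  set hA := isHermitian_conjTranspose_mul_self A
  calc ∑ i, ‖toEuclideanLin A (u i)‖ ^ (2 * t)
      ≤ ∑ i, ∑ k, (inner ℝ (hA.eigenvectorBasis k) (u i)) ^ 2 * hA.eigenvalues k ^ t := by
        refine Finset.sum_le_sum fun i _ => ?_
        rw [Real.rpow_mul (norm_nonneg _), Real.rpow_two, sch_sq]
        refine Real.rpow_arith_mean_le_arith_mean_rpow _ _ _ (fun _ _ => sq_nonneg _) ?_
          (fun k _ => sch_eig_nonneg A k) ht
        rw [hA.eigenvectorBasis.sum_sq_inner_right]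
        simp
    _ = ∑ k, hA.eigenvalues k ^ t := by
        rw [Finset.sum_comm]
        refine Finset.sum_congr rfl fun k _ => ?_
        rw [← Finset.sum_mul, u.sum_sq_inner_left]
        simp

lemma sch_eq {R C : Type*} [Fintype R] [Fintype C] [DecidableEq C] (A : Matrix R C ℝ) (t : ℝ) :
    schattenNorm t A = (∑ i, ‖toEuclideanLin A
      ((isHermitian_conjTranspose_mul_self A).eigenvectorBasis i)‖ ^ (2 * t)) ^ (1 / (2 * t)) := by
  rw [schattenNorm, one_div, schattenPow]
  congr 1
  refine Finset.sum_congr rfl fun i _ => ?_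
  rw [Real.rpow_mul (norm_nonneg _), Real.rpow_two, sch_sq]
  congr 1
  rw [Finset.sum_eq_single i]
  · simp
  · intro k _ hk
    rw [OrthonormalBasis.inner_eq_ite]
    simp [hk]
  · simp

lemma sch_add {R C : Type*} [Fintype R] [Fintype C] [DecidableEq C] (A B : Matrix R C ℝ)
    {t : ℝ} (ht : 1 ≤ t) : schattenNorm t (A + B) ≤ schattenNorm t A + schattenNorm t B := by
  set u := (isHermitian_conjTranspose_mul_self (A + B)).eigenvectorBasis with hu
  refine le_trans ?_ (add_le_add (sch_le A u ht) (sch_le B u ht))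
  rw [sch_eq, ← hu]
  refine le_trans ?_ (Real.Lp_add_le_of_nonneg Finset.univ (by linarith)
    (fun i _ => norm_nonneg _) (fun i _ => norm_nonneg _))
  refine Real.rpow_le_rpow (Finset.sum_nonneg fun i _ => by positivity) ?_ (by positivity)
  refine Finset.sum_le_sum fun i _ => ?_
  refine Real.rpow_le_rpow (norm_nonneg _) ?_ (by positivity)
  rw [map_add, LinearMap.add_apply]
  exact norm_add_le _ _

lemma sch_smul {R C : Type*} [Fintype R] [Fintype C] [DecidableEq C] (A : Matrix R C ℝ) (c : ℝ)
    {t : ℝ} (ht : 1 ≤ t) : schattenNorm t (c • A) ≤ |c| * schattenNorm t A := by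
  set u := (isHermitian_conjTranspose_mul_self (c • A)).eigenvectorBasis with hu
  refine le_trans ?_ (mul_le_mul_of_nonneg_left (sch_le A u ht) (abs_nonneg c))
  rw [sch_eq, ← hu]
  have h : ∀ i, ‖toEuclideanLin (c • A) (u i)‖ ^ (2 * t)
      = |c| ^ (2 * t) * ‖toEuclideanLin A (u i)‖ ^ (2 * t) := by
    intro i
    rw [map_smul, LinearMap.smul_apply, norm_smul, Real.mul_rpow (norm_nonneg _) (norm_nonneg _),
      Real.norm_eq_abs]
  simp_rw [h]
  rw [← Finset.mul_sum, Real.mul_rpow (by positivity) (Finset.sum_nonneg fun i _ => by positivity),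
    one_div, Real.rpow_rpow_inv (abs_nonneg _) (by positivity)]

lemma sch_zero {R C : Type*} [Fintype R] [Fintype C] [DecidableEq C]
    {t : ℝ} (ht : 1 ≤ t) : schattenNorm t (0 : Matrix R C ℝ) = 0 := by
  have h1 := sch_smul (0 : Matrix R C ℝ) 0 ht
  have h2 : 0 ≤ schattenNorm t (0 : Matrix R C ℝ) := by rw [sch_eq]; positivity
  simp at h1
  linarith

/-- The Schatten norm as a seminorm. -/
noncomputable def schSeminorm (R C : Type*) [Fintype R] [Fintype C] [DecidableEq C]
    (t : ℝ) (ht : 1 ≤ t) : Seminorm ℝ (Matrix R C ℝ) :=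
  Seminorm.ofSMulLE (schattenNorm t) (sch_zero ht) (fun A B => sch_add A B ht)
    (fun c A => sch_smul A c ht)

lemma semi_cont {T : Type*} [Fintype T] (P : Seminorm ℝ (T → ℝ)) : Continuous P := by
  have := (P.convexOn).continuousOn isOpen_univ
  exact continuousOn_univ.1 this

lemma semi_int {T X : Type*} [Fintype T] [MeasurableSpace X] {π : Measure X}
    (P : Seminorm ℝ (T → ℝ)) {f : X → T → ℝ} (hf : ∀ j, Integrable (fun x => f x j) π) :
    Integrable (fun x => P (f x)) π := by
  obtain ⟨C, hC, h⟩ := P.bound_of_continuous_normedSpace (semi_cont P)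
  have hf' : Integrable f π := Integrable.of_eval hf
  refine Integrable.mono' (hf'.norm.const_mul C)
    ((semi_cont P).comp_aestronglyMeasurable hf'.1) ?_
  refine Filter.Eventually.of_forall fun x => ?_
  rw [Real.norm_of_nonneg (apply_nonneg P _)]
  exact h _

lemma semi_jensen {T X : Type*} [Fintype T] [MeasurableSpace X] {π : Measure X}
    [IsProbabilityMeasure π]
    (P : Seminorm ℝ (T → ℝ)) {f : X → T → ℝ} (hf : ∀ j, Integrable (fun x => f x j) π) :
    P (fun j => ∫ x, f x j ∂π) ≤ ∫ x, P (f x) ∂π := by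
  have h := P.convexOn.map_integral_le (μ := π) (f := f) (semi_cont P).continuousOn isClosed_univ
    (by simp) (Integrable.of_eval hf) (semi_int P hf)
  have e : (fun j => ∫ x, f x j ∂π) = ∫ x, f x ∂π := by
    ext j
    rw [eval_integral hf]
  rw [e]
  exact h

lemma mix_mp {κ : Type*} [Fintype κ] (ν : κ → Measure ℝ) [∀ k, IsProbabilityMeasure (ν k)]
    (s : κ → Prop) [DecidablePred s] :
    MeasurePreserving (fun z : (κ → ℝ) × (κ → ℝ) => fun k => if s k then z.1 k else z.2 k)
      ((Measure.pi ν).prod (Measure.pi ν)) (Measure.pi ν) := by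
  have hm : Measurable (fun z : (κ → ℝ) × (κ → ℝ) => fun k => if s k then z.1 k else z.2 k) := by
    refine measurable_pi_lambda _ fun k => ?_
    split_ifs <;> fun_prop
  refine ⟨hm, ?_⟩
  symm
  refine Measure.pi_eq fun A hA => ?_
  rw [Measure.map_apply hm (MeasurableSet.univ_pi hA)]
  have : (fun z : (κ → ℝ) × (κ → ℝ) => fun k => if s k then z.1 k else z.2 k) ⁻¹' (Set.univ.pi A)
      = (Set.univ.pi fun k => if s k then A k else Set.univ) ×ˢ
        (Set.univ.pi fun k => if s k then Set.univ else A k) := by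
    ext z
    simp only [Set.mem_preimage, Set.mem_pi, Set.mem_univ, true_implies, Set.mem_prod,
      ← forall_and]
    refine forall_congr' fun k => ?_
    split_ifs <;> simp
  rw [this, Measure.prod_prod, Measure.pi_pi, Measure.pi_pi, ← Finset.prod_mul_distrib]
  refine Finset.prod_congr rfl fun k _ => ?_
  split_ifs <;> simp

lemma prod_graph {n d : ℕ} (j : Fin d → Fin n) (F : Fin d → Fin n → ℝ) :
    ∏ m, F m (j m) = ∏ k : Fin d × Fin n, if k.2 = j k.1 then F k.1 k.2 else 1 := by
  rw [Fintype.prod_prod_type]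
  simp

lemma int_graph {n d : ℕ} (ν : Fin n → Measure ℝ) [∀ k, IsProbabilityMeasure (ν k)]
    (F : Fin d → Fin n → ℝ → ℝ) (hF : ∀ m i, Integrable (F m i) (ν i)) (j : Fin d → Fin n) :
    Integrable (fun w : Fin d × Fin n → ℝ => ∏ m, F m (j m) (w (m, j m)))
      (Measure.pi fun k : Fin d × Fin n => ν k.2) := by
  simp_rw [fun w : Fin d × Fin n → ℝ => prod_graph j (fun m i => F m i (w (m, i)))]
  refine Integrable.fintype_prod (f := fun (k : Fin d × Fin n) (z : ℝ) =>
    if k.2 = j k.1 then F k.1 k.2 z else 1) fun k => ?_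
  split_ifs
  · exact hF _ _
  · exact integrable_const _

lemma integral_graph {n d : ℕ} (ν : Fin n → Measure ℝ) [∀ k, IsProbabilityMeasure (ν k)]
    (F : Fin d → Fin n → ℝ → ℝ) (j : Fin d → Fin n) :
    ∫ w : Fin d × Fin n → ℝ, ∏ m, F m (j m) (w (m, j m))
      ∂(Measure.pi fun k : Fin d × Fin n => ν k.2) = ∏ m, ∫ z, F m (j m) z ∂(ν (j m)) := by
  simp_rw [fun w : Fin d × Fin n → ℝ => prod_graph j (fun m i => F m i (w (m, i)))]
  rw [prod_graph j (fun m i => ∫ z, F m i z ∂(ν i)), integral_fintype_prod_eq_prod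
    (f := fun (k : Fin d × Fin n) (z : ℝ) => if k.2 = j k.1 then F k.1 k.2 z else 1)]
  refine Finset.prod_congr rfl fun k _ => ?_
  split_ifs <;> simp

lemma step_jensen {n d : ℕ} (ν : Fin n → Measure ℝ) [∀ k, IsProbabilityMeasure (ν k)]
    (hint : ∀ i, Integrable (fun z : ℝ => z) (ν i)) (hmean : ∀ i, ∫ z, z ∂(ν i) = 0)
    (P : Seminorm ℝ ((Fin d → Fin n) → ℝ)) (δ : Fin n → Fin d) :
    ∫ a : Fin d × Fin n → ℝ, P (fun j => if ∀ m, δ (j m) = m then ∏ m, a (m, j m) else 0)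
      ∂(Measure.pi fun k : Fin d × Fin n => ν k.2)
    ≤ ∫ w : Fin d × Fin n → ℝ, P (fun j => ∏ m, w (m, j m))
      ∂(Measure.pi fun k : Fin d × Fin n => ν k.2) := by
  set π := (Measure.pi fun k : Fin d × Fin n => ν k.2) with hπ
  have hI : ∀ j : Fin d → Fin n, Integrable (fun w : Fin d × Fin n → ℝ => ∏ m, w (m, j m)) π :=
    fun j => int_graph ν (fun _ _ z => z) (fun _ i => hint i) j
  have hP := semi_int P hI
  have hmp := mix_mp (fun k : Fin d × Fin n => ν k.2) (fun k => δ k.2 = k.1)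
  have hPm : Integrable (fun z : (Fin d × Fin n → ℝ) × (Fin d × Fin n → ℝ) => P (fun j => ∏ m,
      (if δ (j m) = m then z.1 (m, j m) else z.2 (m, j m)))) (π.prod π) :=
    hmp.integrable_comp_of_integrable hP
  have e1 : ∫ w, P (fun j => ∏ m, w (m, j m)) ∂π = ∫ z, P (fun j => ∏ m,
      (if δ (j m) = m then z.1 (m, j m) else z.2 (m, j m))) ∂(π.prod π) := by
    conv_lhs => rw [hπ, ← hmp.map_eq]
    rw [integral_map hmp.measurable.aemeasurable]
    rw [hmp.map_eq]
    exact hP.1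
  rw [e1, integral_prod _ hPm]
  refine integral_mono ?_ hPm.integral_prod_left ?_
  · refine semi_int P fun j => ?_
    split_ifs
    · exact hI j
    · exact integrable_const _
  · intro a
    have hint' : ∀ j : Fin d → Fin n, Integrable (fun b : Fin d × Fin n → ℝ => ∏ m,
        (if δ (j m) = m then a (m, j m) else b (m, j m))) π := by
      intro j
      refine int_graph ν (fun m i z => if δ i = m then a (m, i) else z) (fun m i => ?_) j
      split_ifs
      · exact integrable_const _
      · exact hint i
    refine le_trans (le_of_eq ?_) (semi_jensen P hint')
    dsimp only
    congr 1
    ext j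
    rw [integral_graph ν (fun m i z => if δ i = m then a (m, i) else z) j]
    split_ifs with h
    · refine Finset.prod_congr rfl fun m _ => ?_
      simp [h m]
    · push Not at h
      obtain ⟨m, hm⟩ := h
      symm
      refine Finset.prod_eq_zero (Finset.mem_univ m) ?_
      simp [hm, hmean]

lemma count_delta {n d : ℕ} (j : Fin d → Fin n) (hj : Function.Injective j) :
    (Finset.univ.filter fun δ : Fin n → Fin d => ∀ m, δ (j m) = m).card * d ^ d = d ^ n := by
  classical
  have h1 : (Finset.univ.filter fun δ : Fin n → Fin d => ∀ m, δ (j m) = m)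
      = Fintype.piFinset fun i => Finset.univ.filter fun k : Fin d => ∀ m, j m = i → k = m := by
    ext δ
    simp only [Finset.mem_filter, Finset.mem_univ, true_and, Fintype.mem_piFinset]
    constructor
    · rintro h i m rfl
      exact h m
    · intro h m
      exact h _ m rfl
  have h2 : ∀ i, (Finset.univ.filter fun k : Fin d => ∀ m, j m = i → k = m).card
      = if i ∈ Finset.univ.image j then 1 else d := by
    intro i
    split_ifs with h
    · simp only [Finset.mem_image, Finset.mem_univ, true_and] at h
      obtain ⟨m, rfl⟩ := h
      rw [Finset.card_eq_one]
      refine ⟨m, ?_⟩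
      ext k
      simp only [Finset.mem_filter, Finset.mem_univ, true_and, Finset.mem_singleton]
      constructor
      · intro h
        exact h m rfl
      · rintro rfl m' hm'
        exact (hj hm').symm
    · rw [Finset.filter_true_of_mem]
      · simp
      · intro k _ m hm
        exact absurd (Finset.mem_image.2 ⟨m, Finset.mem_univ _, hm⟩) h
  have h3 : d ^ d = ∏ i : Fin n, if i ∈ Finset.univ.image j then d else 1 := by
    rw [Finset.prod_ite_mem, Finset.univ_inter, Finset.prod_const,
      Finset.card_image_of_injective _ hj]
    simp
  have h4 : d ^ n = ∏ i : Fin n, d := by simp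
  rw [h1, Fintype.card_piFinset, h3, h4, ← Finset.prod_mul_distrib]
  refine Finset.prod_congr rfl fun i _ => ?_
  rw [h2]
  split_ifs <;> simp

/-- The seminorm on coefficient families. -/
noncomputable def coefSeminorm {n d : ℕ} {R C : Type*} [Fintype R] [Fintype C] [DecidableEq C]
    (B : (Fin d → Fin n) → Matrix R C ℝ) (t : ℝ) (ht : 1 ≤ t) :
    Seminorm ℝ ((Fin d → Fin n) → ℝ) :=
  (schSeminorm R C t ht).comp (∑ j ∈ Finset.univ.filter
    (fun j : Fin d → Fin n => Function.Injective j),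
      (LinearMap.proj j : ((Fin d → Fin n) → ℝ) →ₗ[ℝ] ℝ).smulRight (B j))

lemma coefSeminorm_apply {n d : ℕ} {R C : Type*} [Fintype R] [Fintype C] [DecidableEq C]
    (B : (Fin d → Fin n) → Matrix R C ℝ) (t : ℝ) (ht : 1 ≤ t) (v : (Fin d → Fin n) → ℝ) :
    coefSeminorm B t ht v = schattenNorm t (∑ j ∈ Finset.univ.filter
      (fun j : Fin d → Fin n => Function.Injective j), v j • B j) := by
  rw [coefSeminorm, Seminorm.comp_apply, LinearMap.sum_apply]
  rfl

lemma coef_avg {n d : ℕ} (hd : d ≠ 0) {R C : Type*} [Fintype R] [Fintype C] [DecidableEq C]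
    (B : (Fin d → Fin n) → Matrix R C ℝ) (t : ℝ) (ht : 1 ≤ t) (v : (Fin d → Fin n) → ℝ) :
    coefSeminorm B t ht v ≤ (d : ℝ) ^ d / (d : ℝ) ^ n * ∑ δ : Fin n → Fin d,
      coefSeminorm B t ht (fun j => if ∀ m, δ (j m) = m then v j else 0) := by
  have hc : (0 : ℝ) ≤ (d : ℝ) ^ d / (d : ℝ) ^ n := by positivity
  have hd' : (d : ℝ) ^ n ≠ 0 := by positivity
  have key : coefSeminorm B t ht v = coefSeminorm B t ht (((d : ℝ) ^ d / (d : ℝ) ^ n) •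
      ∑ δ : Fin n → Fin d, (fun j => if ∀ m, δ (j m) = m then v j else 0)) := by
    rw [coefSeminorm_apply, coefSeminorm_apply]
    congr 1
    refine Finset.sum_congr rfl fun j hj => ?_
    congr 1
    have hj' := (Finset.mem_filter.1 hj).2
    have hcount := count_delta j hj'
    rw [Pi.smul_apply, Finset.sum_apply, ← Finset.sum_filter, Finset.sum_const, nsmul_eq_mul,
      smul_eq_mul, ← mul_assoc]
    have : (d : ℝ) ^ d / (d : ℝ) ^ n *
      ((Finset.univ.filter fun δ : Fin n → Fin d => ∀ m, δ (j m) = m).card : ℝ) = 1 := by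
      rw [div_mul_eq_mul_div, div_eq_one_iff_eq hd', mul_comm]
      exact_mod_cast hcount
    rw [this, one_mul]
  rw [key, map_smul_eq_mul, Real.norm_of_nonneg hc]
  refine mul_le_mul_of_nonneg_left ?_ hc
  exact Finset.le_sum_of_subadditive _ (map_zero _).le (map_add_le_add _) _ _

/-- **Decoupling inequality** (Lemma 3.2). Let `x = (x 1, …, x n)` be independent mean-zero
real random variables, let `{B j}` be deterministic matrices of a common dimension indexed
by `d`-tuples of distinct indices, and let `y 1, …, y d` be `d` independent copies of the
sequence `x` (so the whole family `{y m i}` is jointly independent, with `y m i`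
distributed as `x i`). Then for every `1 ≤ t < ∞`,
`E ‖∑_{j ∈ T^d_n} B j ∏ m x (j m)‖_{2t} ≤ d^d • E ‖∑_{j ∈ T^d_n} B j ∏ m (y m) (j m)‖_{2t}`. -/
theorem decoupling_inequality
    {Ω : Type*} [MeasurableSpace Ω] (μ : Measure Ω) [IsProbabilityMeasure μ]
    (n d : ℕ) {d₁ d₂ : Type*} [Fintype d₁] [Fintype d₂] [DecidableEq d₂]
    (x : Fin n → Ω → ℝ) (y : Fin d → Fin n → Ω → ℝ)
    (hxmeas : ∀ i, Measurable (x i))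
    (hymeas : ∀ m i, Measurable (y m i))
    (hxindep : iIndepFun x μ)
    (hyindep : iIndepFun (fun mi : Fin d × Fin n => y mi.1 mi.2) μ)
    (hxint : ∀ i, Integrable (x i) μ)
    (hxmean : ∀ i, ∫ ω, x i ω ∂μ = 0)
    (hcopy : ∀ m i, IdentDistrib (y m i) (x i) μ μ)
    (B : (Fin d → Fin n) → Matrix d₁ d₂ ℝ)
    (t : ℝ) (ht : 1 ≤ t) :
    ∫ ω, schattenNorm t (∑ j ∈ Finset.univ.filter
          (fun j : Fin d → Fin n => Function.Injective j),
        (∏ m, x (j m) ω) • B j) ∂μ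
      ≤ (d : ℝ) ^ d *
        ∫ ω, schattenNorm t (∑ j ∈ Finset.univ.filter
              (fun j : Fin d → Fin n => Function.Injective j),
            (∏ m, y m (j m) ω) • B j) ∂μ := by
  classical
  simp_rw [fun ω => (coefSeminorm_apply B t ht (fun j => ∏ m, x (j m) ω)).symm,
    fun ω => (coefSeminorm_apply B t ht (fun j => ∏ m, y m (j m) ω)).symm]
  set P := coefSeminorm B t ht with hP
  rcases Nat.eq_zero_or_pos d with rfl | hd
  · simp
  have hd0 : d ≠ 0 := hd.ne'
  have hdR : (d : ℝ) ^ n ≠ 0 := by positivity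
  let ν : Fin n → Measure ℝ := fun i => μ.map (x i)
  have : ∀ i, IsProbabilityMeasure (ν i) := fun i =>
    Measure.isProbabilityMeasure_map (hxmeas i).aemeasurable
  have hint : ∀ i, Integrable (fun z : ℝ => z) (ν i) := fun i =>
    (integrable_map_measure (by fun_prop) (hxmeas i).aemeasurable).2 (hxint i)
  have hmean : ∀ i, ∫ z, z ∂(ν i) = 0 := fun i => by
    rw [integral_map (hxmeas i).aemeasurable (by fun_prop)]
    exact hxmean i
  set π := (Measure.pi fun k : Fin d × Fin n => ν k.2) with hπ
  have hlawy : μ.map (fun ω (k : Fin d × Fin n) => y k.1 k.2 ω) = π := by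
    rw [iIndepFun.map_fun_eq_pi_map (f := fun (k : Fin d × Fin n) => y k.1 k.2)
      (fun k => (hymeas k.1 k.2).aemeasurable) hyindep]
    congr 1
    ext1 k
    exact (hcopy k.1 k.2).map_eq
  have hlawx : μ.map (fun ω i => x i ω) = Measure.pi ν :=
    iIndepFun.map_fun_eq_pi_map (fun k => (hxmeas k).aemeasurable) hxindep
  have hlawδ : ∀ δ : Fin n → Fin d, μ.map (fun ω i => y (δ i) i ω) = Measure.pi ν := by
    intro δ
    have h := hyindep.precomp (g := fun i : Fin n => (δ i, i)) (fun a b h => (Prod.ext_iff.1 h).2)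
    rw [iIndepFun.map_fun_eq_pi_map (f := fun i : Fin n => y (δ i) i)
      (fun k => (hymeas (δ k) k).aemeasurable) h]
    congr 1
    ext1 k
    exact (hcopy (δ k) k).map_eq
  have hmy : Measurable (fun ω (k : Fin d × Fin n) => y k.1 k.2 ω) :=
    measurable_pi_lambda _ fun k => hymeas _ _
  have hmx : Measurable (fun ω i => x i ω) := measurable_pi_lambda _ fun k => hxmeas _
  have hmδ : ∀ δ : Fin n → Fin d, Measurable (fun ω i => y (δ i) i ω) := fun δ =>
    measurable_pi_lambda _ fun k => hymeas _ _
  have hcP := semi_cont P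
  have hRHS : ∫ ω, P (fun j => ∏ m, y m (j m) ω) ∂μ = ∫ w, P (fun j => ∏ m, w (m, j m)) ∂π := by
    rw [← hlawy, integral_map hmy.aemeasurable]
    exact (hcP.comp (by fun_prop)).aestronglyMeasurable
  have hcδ : ∀ δ : Fin n → Fin d, Continuous (fun u : Fin n → ℝ =>
      P (fun j => if ∀ m, δ (j m) = m then ∏ m, u (j m) else 0)) := by
    intro δ
    refine hcP.comp (continuous_pi fun j => ?_)
    split_ifs <;> fun_prop
  have hcδ' : ∀ δ : Fin n → Fin d, Continuous (fun a : Fin d × Fin n → ℝ =>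
      P (fun j => if ∀ m, δ (j m) = m then ∏ m, a (m, j m) else 0)) := by
    intro δ
    refine hcP.comp (continuous_pi fun j => ?_)
    split_ifs <;> fun_prop
  have hyeq : ∀ (δ : Fin n → Fin d) ω, (fun j : Fin d → Fin n => if ∀ m, δ (j m) = m then
      ∏ m, y (δ (j m)) (j m) ω else 0) = (fun j => if ∀ m, δ (j m) = m then
      ∏ m, y m (j m) ω else 0) := by
    intro δ ω
    ext j
    split_ifs with h
    · refine Finset.prod_congr rfl fun m _ => ?_
      rw [h m]
    · rfl
  have hstep : ∀ δ : Fin n → Fin d,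
      ∫ ω, P (fun j => if ∀ m, δ (j m) = m then ∏ m, x (j m) ω else 0) ∂μ
      ≤ ∫ ω, P (fun j => ∏ m, y m (j m) ω) ∂μ := by
    intro δ
    rw [hRHS]
    refine le_trans (le_of_eq ?_) (step_jensen ν hint hmean P δ)
    rw [← hπ, ← hlawy, integral_map hmy.aemeasurable (hcδ' δ).aestronglyMeasurable]
    dsimp only
    have a1 := integral_map (μ := μ) hmx.aemeasurable (hcδ δ).aestronglyMeasurable
    have a2 := integral_map (μ := μ) (hmδ δ).aemeasurable (hcδ δ).aestronglyMeasurable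
    rw [hlawx] at a1
    rw [hlawδ δ] at a2
    rw [← a1, a2]
    simp_rw [hyeq]
  have hintδ : ∀ δ : Fin n → Fin d, Integrable (fun ω =>
      P (fun j => if ∀ m, δ (j m) = m then ∏ m, x (j m) ω else 0)) μ := by
    intro δ
    have b1 : Integrable (fun a : Fin d × Fin n → ℝ =>
        P (fun j => if ∀ m, δ (j m) = m then ∏ m, a (m, j m) else 0)) π := by
      refine semi_int P fun j => ?_
      split_ifs
      · exact int_graph ν (fun _ _ z => z) (fun _ i => hint i) j
      · exact integrable_const _
    rw [← hlawy, integrable_map_measure (hcδ' δ).aestronglyMeasurable hmy.aemeasurable] at b1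
    have b2 : Integrable (fun u : Fin n → ℝ =>
        P (fun j => if ∀ m, δ (j m) = m then ∏ m, u (j m) else 0)) (Measure.pi ν) := by
      rw [← hlawδ δ, integrable_map_measure (hcδ δ).aestronglyMeasurable (hmδ δ).aemeasurable]
      refine b1.congr (Filter.Eventually.of_forall fun ω => ?_)
      simp only [Function.comp_apply, hyeq]
    rw [← hlawx, integrable_map_measure (hcδ δ).aestronglyMeasurable hmx.aemeasurable] at b2
    exact b2
  calc ∫ ω, P (fun j => ∏ m, x (j m) ω) ∂μ
      ≤ ∫ ω, (d : ℝ) ^ d / (d : ℝ) ^ n * ∑ δ : Fin n → Fin d,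
        P (fun j => if ∀ m, δ (j m) = m then ∏ m, x (j m) ω else 0) ∂μ := by
        refine integral_mono_of_nonneg (Filter.Eventually.of_forall fun ω => apply_nonneg P _)
          ((integrable_finset_sum _ fun δ _ => hintδ δ).const_mul _)
          (Filter.Eventually.of_forall fun ω => coef_avg hd0 B t ht _)
    _ = (d : ℝ) ^ d / (d : ℝ) ^ n * ∑ δ : Fin n → Fin d,
        ∫ ω, P (fun j => if ∀ m, δ (j m) = m then ∏ m, x (j m) ω else 0) ∂μ := by
        rw [integral_const_mul, integral_finset_sum _ fun δ _ => hintδ δ]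
    _ ≤ (d : ℝ) ^ d / (d : ℝ) ^ n * ∑ δ : Fin n → Fin d,
        ∫ ω, P (fun j => ∏ m, y m (j m) ω) ∂μ := by
        refine mul_le_mul_of_nonneg_left (Finset.sum_le_sum fun δ _ => hstep δ) (by positivity)
    _ = (d : ℝ) ^ d * ∫ ω, P (fun j => ∏ m, y m (j m) ω) ∂μ := by
        rw [Finset.sum_const, nsmul_eq_mul, Finset.card_univ, Fintype.card_fun]
        simp only [Fintype.card_fin, Nat.cast_pow]
        field_simp
end

section
/- Let G = (V, E) be a fixed simple graph with |V| = k vertices v_1,...,v_k and |E| = d ordered edges (i_1,j_1),...,(i_d,j_d), where d ≤ k(k−1). Let {Z_{φ(i),φ(j)}} (for φ ∈ T^k_n and (i,j) ∈ E) be a family of independent mean-zero real random variables, and let {B_{φ(E)}}_{φ ∈ T^k_n} be deterministic real matrices of a common dimension. Then for every 1 ≤ t < ∞, E ‖Σ_{φ ∈ T^k_n} B_{φ(E)} · Π_{(i,j) ∈ E} Z_{φ(i),φ(j)}‖_{2t} ≤ k^k · E ‖Σ_{φ ∈ T^k_n} B_{φ(E)} · Z^{(1)}_{φ(i_1),φ(j_1)}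 ⋯ Z^{(d)}_{φ(i_d),φ(j_d)}‖_{2t}, where z^{(1)},...,z^{(d)} are d independent copies of the whole family z = {Z_{φ(i),φ(j)}}. -/
open MeasureTheory ProbabilityTheory Matrix
open scoped BigOperators ENNReal

open Finset in
theorem normSq_eig {R C : Type*} [Fintype R] [Fintype C] [DecidableEq C]
    (A : Matrix R C ℝ) (x : EuclideanSpace ℝ C) :
    ‖Matrix.toEuclideanLin A x‖ ^ 2 =
      ∑ j, ‖inner ℝ ((Matrix.isHermitian_conjTranspose_mul_self A).eigenvectorBasis j) x‖ ^ 2 *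
        (Matrix.isHermitian_conjTranspose_mul_self A).eigenvalues j := by
  classical
  set hA := Matrix.isHermitian_conjTranspose_mul_self A
  set v := hA.eigenvectorBasis
  have key : ∀ j, inner ℝ (Matrix.toEuclideanLin A x) (Matrix.toEuclideanLin A (v j))
      = hA.eigenvalues j * inner ℝ x (v j) := by
    intro j
    have h1 : Matrix.toEuclideanLin (Aᴴ * A) (v j) = hA.eigenvalues j • v j := by
      have := hA.mulVec_eigenvectorBasis j
      ext i
      have := congrFun this i
      simpa [v] using this
    have h2 : Matrix.toEuclideanLin (Aᴴ * A) (v j) =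
        Matrix.toEuclideanLin Aᴴ (Matrix.toEuclideanLin A (v j)) := by
      ext i
      simp [Matrix.toLpLin_apply]
    rw [h2, Matrix.toEuclideanLin_conjTranspose_eq_adjoint] at h1
    rw [← LinearMap.adjoint_inner_right, h1, inner_smul_right]
  have hx : x = ∑ j, inner ℝ (v j) x • v j := (v.sum_repr' x).symm
  rw [← real_inner_self_eq_norm_sq]
  conv_lhs => rw [show inner ℝ (Matrix.toEuclideanLin A x) (Matrix.toEuclideanLin A x) =
    inner ℝ (Matrix.toEuclideanLin A x) (Matrix.toEuclideanLin A (∑ j, inner ℝ (v j) x • v j)) by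
      rw [← hx]]
  rw [map_sum, inner_sum]
  refine Finset.sum_congr rfl fun j _ => ?_
  rw [map_smul, inner_smul_right, key, real_inner_comm (v j) x, Real.norm_eq_abs, sq_abs]
  ring

theorem eigval_nonneg {R C : Type*} [Fintype R] [Fintype C] [DecidableEq C]
    (A : Matrix R C ℝ) (j : C) :
    0 ≤ (Matrix.isHermitian_conjTranspose_mul_self A).eigenvalues j :=
  (Matrix.posSemidef_conjTranspose_mul_self A).eigenvalues_nonneg j

theorem sq_rpow_half (a t : ℝ) (ha : 0 ≤ a) : a ^ (2 * t) = (a ^ 2) ^ t := by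
  rw [Real.rpow_mul ha]; norm_num

theorem schattenPow_eq {R C : Type*} [Fintype R] [Fintype C] [DecidableEq C]
    (t : ℝ) (A : Matrix R C ℝ) :
    schattenPow t A = ∑ i, ‖Matrix.toEuclideanLin A
      ((Matrix.isHermitian_conjTranspose_mul_self A).eigenvectorBasis i)‖ ^ (2 * t) := by
  unfold schattenPow
  refine Finset.sum_congr rfl fun i _ => ?_
  rw [sq_rpow_half _ _ (norm_nonneg _), normSq_eig]
  congr 1
  rw [Finset.sum_eq_single i]
  · simp
  · intro j _ hj
    rw [OrthonormalBasis.inner_eq_zero _ hj]; simp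
  · simp

theorem le_schattenPow {R C : Type*} [Fintype R] [Fintype C] [DecidableEq C]
    (t : ℝ) (ht : 1 ≤ t) (A : Matrix R C ℝ)
    (u : OrthonormalBasis C ℝ (EuclideanSpace ℝ C)) :
    ∑ i, ‖Matrix.toEuclideanLin A (u i)‖ ^ (2 * t) ≤ schattenPow t A := by
  set v := (Matrix.isHermitian_conjTranspose_mul_self A).eigenvectorBasis with hv
  have h1 : ∀ i, ‖Matrix.toEuclideanLin A (u i)‖ ^ (2 * t) ≤
      ∑ j, ‖inner ℝ (v j) (u i)‖ ^ 2 *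
        (Matrix.isHermitian_conjTranspose_mul_self A).eigenvalues j ^ t := by
    intro i
    rw [sq_rpow_half _ _ (norm_nonneg _), normSq_eig]
    apply Real.rpow_arith_mean_le_arith_mean_rpow
    · intros; positivity
    · rw [OrthonormalBasis.sum_sq_norm_inner_right]; simp
    · intros; exact eigval_nonneg A _
    · exact ht
  refine (Finset.sum_le_sum fun i _ => h1 i).trans ?_
  rw [Finset.sum_comm]
  unfold schattenPow
  apply le_of_eq
  refine Finset.sum_congr rfl fun j _ => ?_
  rw [← Finset.sum_mul, OrthonormalBasis.sum_sq_norm_inner_left]; simp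

theorem schattenPow_nonneg {R C : Type*} [Fintype R] [Fintype C] [DecidableEq C]
    (t : ℝ) (A : Matrix R C ℝ) : 0 ≤ schattenPow t A :=
  Finset.sum_nonneg fun i _ => Real.rpow_nonneg (eigval_nonneg A i) _

theorem schattenNorm_add_le {R C : Type*} [Fintype R] [Fintype C] [DecidableEq C]
    (t : ℝ) (ht : 1 ≤ t) (A B : Matrix R C ℝ) :
    schattenNorm t (A + B) ≤ schattenNorm t A + schattenNorm t B := by
  unfold schattenNorm
  have hp : 0 ≤ (2 * t)⁻¹ := by positivity
  rw [schattenPow_eq t (A + B)]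
  set u := (Matrix.isHermitian_conjTranspose_mul_self (A + B)).eigenvectorBasis
  calc _ ≤ (∑ i, (‖Matrix.toEuclideanLin A (u i)‖ + ‖Matrix.toEuclideanLin B (u i)‖) ^ (2 * t))
        ^ (2 * t)⁻¹ := by
        apply Real.rpow_le_rpow (Finset.sum_nonneg fun i _ => by positivity) _ hp
        refine Finset.sum_le_sum fun i _ => ?_
        apply Real.rpow_le_rpow (norm_nonneg _) _ (by positivity)
        rw [map_add, LinearMap.add_apply]
        exact norm_add_le _ _
    _ ≤ (∑ i, ‖Matrix.toEuclideanLin A (u i)‖ ^ (2 * t)) ^ (2 * t)⁻¹ +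
        (∑ i, ‖Matrix.toEuclideanLin B (u i)‖ ^ (2 * t)) ^ (2 * t)⁻¹ := by
        have := Real.Lp_add_le_of_nonneg (s := Finset.univ) (p := 2 * t)
          (f := fun i => ‖Matrix.toEuclideanLin A (u i)‖)
          (g := fun i => ‖Matrix.toEuclideanLin B (u i)‖) (by linarith)
          (fun _ _ => norm_nonneg _) (fun _ _ => norm_nonneg _)
        simpa only [one_div] using this
    _ ≤ _ := by
        gcongr
        · exact le_schattenPow t ht A u
        · exact le_schattenPow t ht B u

theorem schattenNorm_smul_le {R C : Type*} [Fintype R] [Fintype C] [DecidableEq C]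
    (t : ℝ) (ht : 1 ≤ t) (r : ℝ) (A : Matrix R C ℝ) :
    schattenNorm t (r • A) ≤ ‖r‖ * schattenNorm t A := by
  unfold schattenNorm
  have hp : 0 ≤ (2 * t)⁻¹ := by positivity
  rw [schattenPow_eq t (r • A)]
  set u := (Matrix.isHermitian_conjTranspose_mul_self (r • A)).eigenvectorBasis
  have : ∑ i, ‖Matrix.toEuclideanLin (r • A) (u i)‖ ^ (2 * t) =
      ‖r‖ ^ (2 * t) * ∑ i, ‖Matrix.toEuclideanLin A (u i)‖ ^ (2 * t) := by
    rw [Finset.mul_sum]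
    refine Finset.sum_congr rfl fun i _ => ?_
    rw [map_smul, LinearMap.smul_apply, norm_smul, Real.mul_rpow (norm_nonneg _) (norm_nonneg _)]
  rw [this, Real.mul_rpow (by positivity) (Finset.sum_nonneg fun i _ => by positivity),
    Real.rpow_rpow_inv (norm_nonneg _) (by positivity)]
  gcongr
  · exact le_schattenPow t ht A u

/-- The Schatten norm as a seminorm on the space of arrays. -/
noncomputable def schattenSeminorm {R C : Type*} [Fintype R] [Fintype C] [DecidableEq C]
    (t : ℝ) (ht : 1 ≤ t) : Seminorm ℝ (R → C → ℝ) :=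
  Seminorm.ofSMulLE (fun A => schattenNorm t (A : Matrix R C ℝ))
    (by
      have h := schattenNorm_smul_le t ht 0 (0 : Matrix R C ℝ)
      have h0 : 0 ≤ schattenNorm t (0 : Matrix R C ℝ) := Real.rpow_nonneg (schattenPow_nonneg _ _) _
      simp only [zero_smul, norm_zero, zero_mul] at h
      exact le_antisymm h h0)
    (fun A B => schattenNorm_add_le t ht A B)
    (fun r A => schattenNorm_smul_le t ht r A)

theorem schattenSeminorm_apply {R C : Type*} [Fintype R] [Fintype C] [DecidableEq C]
    (t : ℝ) (ht : 1 ≤ t) (A : R → C → ℝ) :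
    schattenSeminorm t ht A = schattenNorm t (A : Matrix R C ℝ) := rfl

theorem mp_precomp {ι κ : Type*} [Fintype ι] [Fintype κ] (ν : ι → Measure ℝ)
    [∀ i, IsProbabilityMeasure (ν i)] (g : κ → ι) (hg : Function.Injective g) :
    MeasurePreserving (fun (x : ι → ℝ) (i : κ) => x (g i)) (Measure.pi ν)
      (Measure.pi (fun i => ν (g i))) := by
  refine ⟨by fun_prop, ?_⟩
  have h : iIndepFun (fun (i : ι) (x : ι → ℝ) => x i) (Measure.pi ν) :=
    iIndepFun_pi (X := fun i (x : ℝ) => x) (fun i => aemeasurable_id)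
  have h2 := h.precomp hg
  rw [iIndepFun_iff_map_fun_eq_pi_map (fun i => (measurable_pi_apply _).aemeasurable)] at h2
  rw [h2]
  congr 1
  funext i
  exact (measurePreserving_eval ν (g i)).map_eq

section
set_option linter.unusedSectionVars false
variable {Φ I D K E : Type*} [Fintype Φ] [Fintype I] [Fintype D] [DecidableEq K]
  [NormedAddCommGroup E] [NormedSpace ℝ E] [FiniteDimensional ℝ E]

theorem prodInt {ι κ : Type*} [Fintype ι] [Fintype κ] (ν : ι → Measure ℝ)
    [∀ i, IsProbabilityMeasure (ν i)] (hint : ∀ i, Integrable (fun x => x) (ν i))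
    (g : κ → ι) (hg : Function.Injective g) :
    Integrable (fun x : ι → ℝ => ∏ m, x (g m)) (Measure.pi ν) := by
  have := Integrable.fintype_prod (f := fun (_ : κ) (x : ℝ) => x) (μ := fun i => ν (g i))
    (fun i => hint _)
  exact (mp_precomp ν g hg).integrable_comp_of_integrable this

theorem prodInt_eq {ι κ : Type*} [Fintype ι] [Fintype κ] (ν : ι → Measure ℝ)
    [∀ i, IsProbabilityMeasure (ν i)] (hmean : ∀ i, ∫ x, x ∂(ν i) = 0)
    (g : κ → ι) (hg : Function.Injective g) :
    ∫ x : ι → ℝ, ∏ m, x (g m) ∂(Measure.pi ν) = ∏ _m : κ, (0 : ℝ) := by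
  have := integral_fintype_prod_eq_prod (fun (_ : κ) (x : ℝ) => x) (μ := fun i => ν (g i))
  rw [← (mp_precomp ν g hg).map_eq, integral_map (Measurable.aemeasurable (by fun_prop))
    (by apply Continuous.aestronglyMeasurable; fun_prop)] at this
  rw [this]
  simp [hmean]

/-- The chaos. -/
noncomputable def chaos {J : Type*} (g : Φ → D → J) (B : Φ → E) (w : J → ℝ) : E :=
  ∑ φ, (∏ m, w (g φ m)) • B φ

theorem chaos_cont {J : Type*} (g : Φ → D → J) (B : Φ → E) : Continuous (chaos g B) := by
  unfold chaos; fun_prop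

theorem semi_cont_s1 (p : Seminorm ℝ E) : Continuous p := by
  have h := p.convexOn.continuousOn isOpen_univ
  exact continuousOn_univ.mp h

theorem semi_int_s1 {Ω : Type*} [MeasurableSpace Ω] {μ : Measure Ω} (p : Seminorm ℝ E) {f : Ω → E}
    (hf : Integrable f μ) : Integrable (fun ω => p (f ω)) μ := by
  obtain ⟨C, hC, h⟩ := p.bound_of_continuous_normedSpace (semi_cont_s1 p)
  refine Integrable.mono' (hf.norm.const_mul C) ?_ ?_
  · exact (semi_cont_s1 p).comp_aestronglyMeasurable hf.1
  · filter_upwards with ω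
    rw [Real.norm_of_nonneg (apply_nonneg p _)]
    exact h _

theorem chaos_int {J : Type*} [Fintype J] (ν : J → Measure ℝ)
    [∀ i, IsProbabilityMeasure (ν i)] (hint : ∀ i, Integrable (fun x => x) (ν i))
    (g : Φ → D → J) (hg : ∀ φ, Function.Injective (g φ)) (B : Φ → E) :
    Integrable (chaos g B) (Measure.pi ν) := by
  unfold chaos
  exact integrable_finsetSum _ fun φ _ => (prodInt ν hint (g φ) (hg φ)).smul_const _

/-- extension by zero -/
noncomputable def ext0 {J : Type*} (S : J → Prop) [DecidablePred S] (u : {j // S j} → ℝ)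
    (j : J) : ℝ := if h : S j then u ⟨j, h⟩ else 0

theorem sub_step {J : Type*} [Fintype J] (ν : J → Measure ℝ)
    [∀ i, IsProbabilityMeasure (ν i)] (hint : ∀ i, Integrable (fun x => x) (ν i))
    (hmean : ∀ i, ∫ x, x ∂(ν i) = 0)
    (g : Φ → D → J) (hg : ∀ φ, Function.Injective (g φ)) (B : Φ → E) (p : Seminorm ℝ E)
    (S : J → Prop) [DecidablePred S] :
    ∫ w, p (chaos g B (ext0 S (fun s => w s.1))) ∂(Measure.pi ν)
      ≤ ∫ w, p (chaos g B w) ∂(Measure.pi ν) := by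
  have hmp := measurePreserving_piEquivPiSubtypeProd ν S
  have hc := chaos_cont g B
  have hp := semi_cont_s1 p
  have hext : Continuous (ext0 (J := J) S) := by
    unfold ext0
    refine continuous_pi fun j => ?_
    by_cases h : S j
    · simp only [h, dite_true]; fun_prop
    · simp only [h, dite_false]; fun_prop
  set e := MeasurableEquiv.piEquivPiSubtypeProd (fun _ : J => ℝ) S with he
  have hsymm : ∀ (u : {j // S j} → ℝ) (v : {j // ¬ S j} → ℝ) (j : J),
      e.symm (u, v) j = if h : S j then u ⟨j, h⟩ else v ⟨j, h⟩ := fun u v j => rfl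
  have hI := semi_int_s1 p (chaos_int ν hint g hg B)
  have hI2 : Integrable (fun z => p (chaos g B (e.symm z)))
      ((Measure.pi fun i : {j // S j} => ν i).prod (Measure.pi fun i : {j // ¬ S j} => ν i)) :=
    hmp.symm.integrable_comp_of_integrable hI
  have h1 : ∫ w, p (chaos g B w) ∂(Measure.pi ν) =
      ∫ z, p (chaos g B (e.symm z)) ∂((Measure.pi fun i : {j // S j} => ν i).prod
        (Measure.pi fun i : {j // ¬ S j} => ν i)) := by
    rw [← hmp.symm.integral_comp']
  have h0 : ∫ w, p (chaos g B (ext0 S (fun s => w s.1))) ∂(Measure.pi ν) =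
      ∫ u, p (chaos g B (ext0 S u)) ∂(Measure.pi fun i : {j // S j} => ν i) := by
    rw [← (mp_precomp ν (fun s : {j // S j} => s.1) Subtype.val_injective).map_eq,
      integral_map (Measurable.aemeasurable (by fun_prop))
        (by apply Continuous.aestronglyMeasurable; fun_prop)]
  rw [h1, h0, integral_prod _ hI2]
  refine integral_mono_of_nonneg (Filter.Eventually.of_forall fun u => apply_nonneg p _)
    hI2.integral_prod_left (Filter.Eventually.of_forall fun u => ?_)
  have hsplit : ∀ φ v, ∏ m, e.symm (u, v) (g φ m) =
      (∏ m : {m // S (g φ m)}, u ⟨g φ m, m.2⟩) *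
        ∏ m : {m // ¬ S (g φ m)}, v ⟨g φ m, m.2⟩ := by
    intro φ v
    rw [← Fintype.prod_subtype_mul_prod_subtype (fun m => S (g φ m))]
    congr 1
    · exact Finset.prod_congr rfl fun m _ => by rw [hsymm, dif_pos m.2]
    · exact Finset.prod_congr rfl fun m _ => by rw [hsymm, dif_neg m.2]
  have hsplit0 : ∀ φ, ∏ m, ext0 S u (g φ m) =
      (∏ m : {m // S (g φ m)}, u ⟨g φ m, m.2⟩) *
        ∏ m : {m // ¬ S (g φ m)}, (0 : ℝ) := by
    intro φ
    rw [← Fintype.prod_subtype_mul_prod_subtype (fun m => S (g φ m))]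
    congr 1
    · exact Finset.prod_congr rfl fun m _ => by rw [ext0, dif_pos m.2]
    · exact Finset.prod_congr rfl fun m _ => by rw [ext0, dif_neg m.2]
  have hinj : ∀ φ, Function.Injective
      (fun m : {m // ¬ S (g φ m)} => (⟨g φ m, m.2⟩ : {j // ¬ S j})) := by
    intro φ a b hab
    exact Subtype.ext (hg φ (congrArg Subtype.val hab))
  have hti : ∀ φ, Integrable (fun v => (∏ m, e.symm (u, v) (g φ m)) • B φ)
      (Measure.pi fun i : {j // ¬ S j} => ν i) := by
    intro φ
    simp_rw [hsplit]
    exact ((prodInt (fun i : {j // ¬ S j} => ν i) (fun i => hint i) _ (hinj φ)).const_mul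
      _).smul_const _
  have hfi : Integrable (fun v => chaos g B (e.symm (u, v)))
      (Measure.pi fun i : {j // ¬ S j} => ν i) := by
    unfold chaos
    exact integrable_finsetSum _ fun φ _ => hti φ
  have hmeanv : ∫ v, chaos g B (e.symm (u, v)) ∂(Measure.pi fun i : {j // ¬ S j} => ν i) =
      chaos g B (ext0 S u) := by
    unfold chaos
    rw [integral_finsetSum _ fun φ _ => hti φ]
    refine Finset.sum_congr rfl fun φ _ => ?_
    rw [integral_smul_const, hsplit0]
    simp_rw [hsplit]
    rw [integral_const_mul,
      prodInt_eq (fun i : {j // ¬ S j} => ν i) (fun i => hmean i) _ (hinj φ)]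
  show p (chaos g B (ext0 S u)) ≤ ∫ v, p (chaos g B (e.symm (u, v))) ∂_
  rw [← hmeanv]
  exact p.convexOn.map_integral_le hp.continuousOn isClosed_univ (by simp) hfi (semi_int_s1 p hfi)

theorem color_step (ν : I → Measure ℝ)
    [∀ i, IsProbabilityMeasure (ν i)] (hint : ∀ i, Integrable (fun x => x) (ν i))
    (hmean : ∀ i, ∫ x, x ∂(ν i) = 0)
    (a : Φ → D → I) (B : Φ → E) (p : Seminorm ℝ E)
    (col : I → K) (e : D → K) (he : Function.Injective e) :
    ∫ z, p (chaos a (fun φ => if ∀ m, col (a φ m) = e m then B φ else 0) z) ∂(Measure.pi ν)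
      ≤ ∫ w, p (chaos (fun φ m => (m, a φ m)) B w)
          ∂(Measure.pi (fun j : D × I => ν j.2)) := by
  have hg : ∀ φ, Function.Injective (fun m => (m, a φ m)) := fun φ x y h => (Prod.ext_iff.1 h).1
  refine le_trans (le_of_eq ?_) (sub_step (fun j : D × I => ν j.2) (fun j => hint _)
    (fun j => hmean _) _ hg B p (fun j => col j.2 = e j.1))
  set S : D × I → Prop := fun j => col j.2 = e j.1
  have hinj : Function.Injective (fun s : {j // S j} => s.1.2) := by
    rintro ⟨⟨m, i⟩, h⟩ ⟨⟨m', i'⟩, h'⟩ heq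
    simp only at heq
    subst heq
    have : m = m' := he (h.symm.trans h')
    subst this
    rfl
  have hext : Continuous (ext0 (J := D × I) S) := by
    unfold ext0
    refine continuous_pi fun j => ?_
    by_cases h : S j
    · simp only [h, dite_true]; fun_prop
    · simp only [h, dite_false]; fun_prop
  have hc := chaos_cont (fun φ m => (m, a φ m)) B
  have hp := semi_cont_s1 p
  have h1 : ∀ z : I → ℝ, chaos a (fun φ => if ∀ m, col (a φ m) = e m then B φ else 0) z =
      chaos (fun φ m => (m, a φ m)) B (ext0 S (fun s => z s.1.2)) := by
    intro z
    unfold chaos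
    refine Finset.sum_congr rfl fun φ _ => ?_
    beta_reduce
    by_cases h : ∀ m, col (a φ m) = e m
    · rw [if_pos h]
      congr 1
      refine Finset.prod_congr rfl fun m _ => ?_
      rw [ext0, dif_pos (h m)]
    · rw [if_neg h]
      push Not at h
      obtain ⟨m, hm⟩ := h
      rw [smul_zero, Finset.prod_eq_zero (Finset.mem_univ m), zero_smul]
      rw [ext0, dif_neg hm]
  simp_rw [h1]
  have e1 := integral_map (μ := Measure.pi ν) (φ := fun (z : I → ℝ) (s : {j // S j}) => z s.1.2)
    (f := fun u => p (chaos (fun φ m => (m, a φ m)) B (ext0 S u))) (Measurable.aemeasurable (by fun_prop))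
        (by apply Continuous.aestronglyMeasurable; fun_prop)
  have e2 := integral_map (μ := Measure.pi (fun j : D × I => ν j.2))
    (φ := fun (z : D × I → ℝ) (s : {j // S j}) => z s.1)
    (f := fun u => p (chaos (fun φ m => (m, a φ m)) B (ext0 S u))) (Measurable.aemeasurable (by fun_prop))
        (by apply Continuous.aestronglyMeasurable; fun_prop)
  rw [← e1, ← e2, (mp_precomp ν _ hinj).map_eq,
    (mp_precomp (fun j : D × I => ν j.2) (fun s : {j // S j} => s.1)
      Subtype.val_injective).map_eq]

theorem avg_step {Γ : Type*} [Fintype Γ] (ν : I → Measure ℝ)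
    [∀ i, IsProbabilityMeasure (ν i)] (hint : ∀ i, Integrable (fun x => x) (ν i))
    (hmean : ∀ i, ∫ x, x ∂(ν i) = 0)
    (a : Φ → D → I) (ha : ∀ φ, Function.Injective (a φ)) (B : Φ → E) (p : Seminorm ℝ E)
    (col : Γ → I → K) (e : D → K) (he : Function.Injective e) (N : ℕ)
    (hN : ∀ φ, (Finset.univ.filter fun c => ∀ m, col c (a φ m) = e m).card = N) :
    N * ∫ z, p (chaos a B z) ∂(Measure.pi ν)
      ≤ Fintype.card Γ * ∫ w, p (chaos (fun φ m => (m, a φ m)) B w)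
          ∂(Measure.pi (fun j : D × I => ν j.2)) := by
  have h1 : ∀ z, N * p (chaos a B z) ≤
      ∑ c, p (chaos a (fun φ => if ∀ m, col c (a φ m) = e m then B φ else 0) z) := by
    intro z
    have : (N : ℝ) • chaos a B z =
        ∑ c, chaos a (fun φ => if ∀ m, col c (a φ m) = e m then B φ else 0) z := by
      unfold chaos
      rw [Finset.sum_comm, Finset.smul_sum]
      refine Finset.sum_congr rfl fun φ _ => ?_
      rw [← Finset.smul_sum, ← Finset.sum_filter, Finset.sum_const, hN, smul_comm,
        Nat.cast_smul_eq_nsmul]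
    calc _ = p ((N : ℝ) • chaos a B z) := by rw [map_smul_eq_mul]; simp
      _ ≤ _ := by rw [this]; exact Finset.le_sum_of_subadditive p (map_zero p).le (map_add_le_add p) _ _
  have hci : ∀ c, Integrable (fun z =>
      p (chaos a (fun φ => if ∀ m, col c (a φ m) = e m then B φ else 0) z)) (Measure.pi ν) :=
    fun c => semi_int_s1 p (chaos_int ν hint a ha _)
  rw [← integral_const_mul]
  calc _ ≤ ∫ z, ∑ c, p (chaos a (fun φ => if ∀ m, col c (a φ m) = e m then B φ else 0) z)
        ∂(Measure.pi ν) :=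
        integral_mono ((semi_int_s1 p (chaos_int ν hint a ha _)).const_mul _)
          (integrable_finsetSum _ fun c _ => hci c) h1
    _ = ∑ c, ∫ z, p (chaos a (fun φ => if ∀ m, col c (a φ m) = e m then B φ else 0) z)
        ∂(Measure.pi ν) := integral_finsetSum _ fun c _ => hci c
    _ ≤ ∑ c : Γ, ∫ w, p (chaos (fun φ m => (m, a φ m)) B w)
          ∂(Measure.pi (fun j : D × I => ν j.2)) :=
        Finset.sum_le_sum fun c _ => color_step ν hint hmean a B p (col c) e he
    _ = _ := by simp

end

theorem count_col {n k d : ℕ} (e : Fin d → Fin k × Fin k) (φ : Fin k → Fin n)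
    (hφ : Function.Injective φ) :
    (Finset.univ.filter fun c : Fin n → Fin k =>
      ∀ m, (c (φ (e m).1), c (φ (e m).2)) = e m).card =
    k ^ (n - (Finset.univ.filter fun i : Fin k => ∃ m, (e m).1 = i ∨ (e m).2 = i).card) := by
  set W := Finset.univ.filter fun i : Fin k => ∃ m, (e m).1 = i ∨ (e m).2 = i with hW
  have h1 : (Finset.univ.filter fun c : Fin n → Fin k =>
      ∀ m, (c (φ (e m).1), c (φ (e m).2)) = e m) =
      Fintype.piFinset (fun x => Finset.univ.filter fun i : Fin k => ∀ j ∈ W, φ j = x → i = j) := by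
    ext c
    simp only [Finset.mem_filter, Finset.mem_univ, true_and, Fintype.mem_piFinset, hW]
    constructor
    · rintro h x j ⟨m, rfl | rfl⟩ rfl
      · exact congrArg Prod.fst (h m)
      · exact congrArg Prod.snd (h m)
    · intro h m
      exact Prod.ext (h _ _ ⟨m, Or.inl rfl⟩ rfl) (h _ _ ⟨m, Or.inr rfl⟩ rfl)
  rw [h1, Fintype.card_piFinset]
  have h2 : ∀ x, (Finset.univ.filter fun i : Fin k => ∀ j ∈ W, φ j = x → i = j).card =
      if x ∈ W.image φ then 1 else k := by
    intro x
    split_ifs with hx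
    · obtain ⟨j, hj, rfl⟩ := Finset.mem_image.1 hx
      rw [Finset.card_eq_one]
      refine ⟨j, ?_⟩
      ext i
      simp only [Finset.mem_filter, Finset.mem_univ, true_and, Finset.mem_singleton]
      constructor
      · intro h; exact h j hj rfl
      · rintro rfl j' _ h; exact (hφ h).symm
    · rw [Finset.filter_true_of_mem, Finset.card_univ, Fintype.card_fin]
      intro i _ j hj hjx
      exact absurd (Finset.mem_image.2 ⟨j, hj, hjx⟩) hx
  simp_rw [h2]
  rw [Finset.prod_ite, Finset.prod_const_one, one_mul, Finset.prod_const]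
  congr 1
  rw [Finset.filter_not, Finset.filter_mem_eq_inter, Finset.univ_inter, ← Finset.compl_eq_univ_sdiff,
    Finset.card_compl, Fintype.card_fin, Finset.card_image_of_injective _ hφ]

/-- **Improved decoupling for random variables with structured indices** (Lemma 3.4).
Let `G` be a fixed simple graph on `k` vertices with `d ≤ k(k-1)` ordered edges
`e 0, …, e (d-1)` (distinct ordered pairs with distinct endpoints), let
`{Z p q : p ≠ q}` be independent mean-zero real random variables, and let `{B φ}` be
deterministic matrices of a common dimension depending only on the edge images `φ(E)`.
Then for every `1 ≤ t < ∞`, with `Zc 0, …, Zc (d-1)` denoting `d` independent copies of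
the whole family `Z`,
`E ‖∑_{φ ∈ T^k_n} B φ ∏_{m} Z (φ (e m).1) (φ (e m).2)‖_{2t}`
`≤ k^k • E ‖∑_{φ ∈ T^k_n} B φ ∏_m (Zc m) (φ (e m).1) (φ (e m).2)‖_{2t}`. -/
theorem graph_decoupling
    {Ω : Type*} [MeasurableSpace Ω] (μ : Measure Ω) [IsProbabilityMeasure μ]
    (n k d : ℕ) (hd : d ≤ k * (k - 1))
    (e : Fin d → Fin k × Fin k)
    (hloop : ∀ m, (e m).1 ≠ (e m).2)
    (hedisj : Function.Injective e)
    {d₁ d₂ : Type*} [Fintype d₁] [Fintype d₂] [DecidableEq d₂]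
    (Z : Fin n → Fin n → Ω → ℝ) (Zc : Fin d → Fin n → Fin n → Ω → ℝ)
    (hZmeas : ∀ p q, Measurable (Z p q))
    (hZcmeas : ∀ m p q, Measurable (Zc m p q))
    (hZindep : iIndepFun
      (fun pq : {pq : Fin n × Fin n // pq.1 ≠ pq.2} => Z pq.1.1 pq.1.2) μ)
    (hZcindep : iIndepFun
      (fun mpq : Fin d × {pq : Fin n × Fin n // pq.1 ≠ pq.2} =>
        Zc mpq.1 mpq.2.1.1 mpq.2.1.2) μ)
    (hZint : ∀ p q, p ≠ q → Integrable (Z p q) μ)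
    (hZmean : ∀ p q, p ≠ q → ∫ ω, Z p q ω ∂μ = 0)
    (hcopy : ∀ m p q, p ≠ q → IdentDistrib (Zc m p q) (Z p q) μ μ)
    (B : (Fin k → Fin n) → Matrix d₁ d₂ ℝ)
    (hB : ∀ φ ψ : Fin k → Fin n,
      (∀ m, φ (e m).1 = ψ (e m).1 ∧ φ (e m).2 = ψ (e m).2) → B φ = B ψ)
    (t : ℝ) (ht : 1 ≤ t) :
    ∫ ω, schattenNorm t (∑ φ ∈ Finset.univ.filter
          (fun φ : Fin k → Fin n => Function.Injective φ),
        (∏ m, Z (φ (e m).1) (φ (e m).2) ω) • B φ) ∂μ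
      ≤ (k : ℝ) ^ k *
        ∫ ω, schattenNorm t (∑ φ ∈ Finset.univ.filter
              (fun φ : Fin k → Fin n => Function.Injective φ),
            (∏ m, Zc m (φ (e m).1) (φ (e m).2) ω) • B φ) ∂μ := by
  rcases Nat.eq_zero_or_pos k with hk | hk
  · subst hk
    have hd0 : d = 0 := by simpa using hd
    subst hd0
    simp
  set p : Seminorm ℝ (d₁ → d₂ → ℝ) := schattenSeminorm t ht with hp
  let I := {pq : Fin n × Fin n // pq.1 ≠ pq.2}
  let Φ := {φ : Fin k → Fin n // Function.Injective φ}
  let ν : I → Measure ℝ := fun i => μ.map (Z i.1.1 i.1.2)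
  have hνp : ∀ i, IsProbabilityMeasure (ν i) := fun i =>
    Measure.isProbabilityMeasure_map (hZmeas _ _).aemeasurable
  have hint : ∀ i, Integrable (fun x => x) (ν i) := fun i =>
    (integrable_map_measure (by fun_prop) (hZmeas _ _).aemeasurable).2 (hZint _ _ i.2)
  have hmean : ∀ i, ∫ x, x ∂(ν i) = 0 := fun i => by
    rw [integral_map (hZmeas _ _).aemeasurable (by fun_prop)]
    exact hZmean _ _ i.2
  let a : Φ → Fin d → I := fun φ m =>
    ⟨(φ.1 (e m).1, φ.1 (e m).2), fun h => hloop m (φ.2 h)⟩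
  have ha : ∀ φ, Function.Injective (a φ) := by
    intro φ m m' h
    have h := congrArg Subtype.val h
    exact hedisj (Prod.ext (φ.2 (congrArg Prod.fst h)) (φ.2 (congrArg Prod.snd h)))
  let B' : Φ → (d₁ → d₂ → ℝ) := fun φ => B φ.1
  have hpc := semi_cont_s1 p
  have e1 : ∫ ω, schattenNorm t (∑ φ ∈ Finset.univ.filter
          (fun φ : Fin k → Fin n => Function.Injective φ),
        (∏ m, Z (φ (e m).1) (φ (e m).2) ω) • B φ) ∂μ =
      ∫ z, p (chaos a B' z) ∂(Measure.pi ν) := by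
    have hlaw := (iIndepFun_iff_map_fun_eq_pi_map
      (fun i : I => (hZmeas i.1.1 i.1.2).aemeasurable)).1 hZindep
    have hc : Continuous (fun z => p (chaos a B' z)) := hpc.comp (chaos_cont a B')
    change _ = ∫ z, p (chaos a B' z) ∂(Measure.pi (fun i : I => μ.map (Z i.1.1 i.1.2)))
    rw [← hlaw, integral_map (Measurable.aemeasurable
      (measurable_pi_lambda _ fun i => hZmeas i.1.1 i.1.2))
      hc.aestronglyMeasurable]
    refine integral_congr_ae (Filter.Eventually.of_forall fun ω => ?_)
    beta_reduce
    rw [Finset.sum_subtype (p := fun φ : Fin k → Fin n => Function.Injective φ) _ (by simp)]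
    rw [hp, schattenSeminorm_apply]
    refine congrArg (schattenNorm t) ?_
    rfl
  have e2 : ∫ ω, schattenNorm t (∑ φ ∈ Finset.univ.filter
              (fun φ : Fin k → Fin n => Function.Injective φ),
            (∏ m, Zc m (φ (e m).1) (φ (e m).2) ω) • B φ) ∂μ =
      ∫ w, p (chaos (fun φ m => (m, a φ m)) B' w)
          ∂(Measure.pi (fun j : Fin d × I => ν j.2)) := by
    have hlaw := (iIndepFun_iff_map_fun_eq_pi_map
      (fun j : Fin d × I => (hZcmeas j.1 j.2.1.1 j.2.1.2).aemeasurable)).1 hZcindep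
    have hc : Continuous (fun w => p (chaos (fun (φ : Φ) m => (m, a φ m)) B' w)) :=
      hpc.comp (chaos_cont (fun (φ : Φ) m => (m, a φ m)) B')
    have hν : (fun j : Fin d × I => ν j.2) =
        fun j : Fin d × I => μ.map (Zc j.1 j.2.1.1 j.2.1.2) := by
      funext j
      exact (hcopy j.1 _ _ j.2.2).map_eq.symm
    rw [hν, ← hlaw, integral_map (Measurable.aemeasurable
      (measurable_pi_lambda _ fun j => hZcmeas j.1 j.2.1.1 j.2.1.2))
      hc.aestronglyMeasurable]
    refine integral_congr_ae (Filter.Eventually.of_forall fun ω => ?_)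
    beta_reduce
    rw [Finset.sum_subtype (p := fun φ : Fin k → Fin n => Function.Injective φ) _ (by simp)]
    rw [hp, schattenSeminorm_apply]
    refine congrArg (schattenNorm t) ?_
    rfl
  rw [e1, e2]
  set W := Finset.univ.filter fun i : Fin k => ∃ m, (e m).1 = i ∨ (e m).2 = i with hW
  have hWk : W.card ≤ k := by simpa using W.card_le_univ
  have key := avg_step (Γ := Fin n → Fin k) ν hint hmean a ha B' p
    (fun c i => (c i.1.1, c i.1.2)) e hedisj (k ^ (n - W.card))
    (fun φ => by
      rw [hW, ← count_col e φ.1 φ.2]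
      congr 1
      ext c
      simp only [Finset.mem_filter, Finset.mem_univ, true_and, a])
  set L := ∫ z, p (chaos a B' z) ∂(Measure.pi ν)
  set Q := ∫ w, p (chaos (fun φ m => (m, a φ m)) B' w)
          ∂(Measure.pi (fun j : Fin d × I => ν j.2))
  have hQ : 0 ≤ Q := integral_nonneg fun w => apply_nonneg p _
  have hcard : ((Fintype.card (Fin n → Fin k) : ℕ) : ℝ) ≤
      ((k ^ (n - W.card) : ℕ) : ℝ) * (k : ℝ) ^ k := by
    rw [Fintype.card_fun, Fintype.card_fin, Fintype.card_fin]
    have : k ^ n ≤ k ^ (n - W.card) * k ^ k := by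
      rw [← pow_add]
      exact Nat.pow_le_pow_right hk (by omega)
    exact_mod_cast this
  have hNpos : (0 : ℝ) < ((k ^ (n - W.card) : ℕ) : ℝ) := by
    exact_mod_cast Nat.pow_pos hk
  refine le_of_mul_le_mul_left ?_ hNpos
  calc _ ≤ _ := key
    _ ≤ _ := mul_le_mul_of_nonneg_right hcard hQ
    _ = _ := by ring
end

section
/- (Non-Hermitian matrix Rosenthal inequality.) Suppose t = 1 or t ≥ 1.5. Let {Y_k} be a finite sequence of independent random real d_1 × d_2 matrices with E[Y_k] = 0 and E ‖Y_k‖_{4t}^{4t} < ∞ for each k. Then E ‖Σ_k Y_k‖_{4t}^{4t} ≤ (16t)^{3t} · ( ‖(Σ_k E[Y_k Y_kᵀ])^{1/2}‖_{4t}^{4t} + ‖(Σ_k E[Y_kᵀ Y_k])^{1/2}‖_{4t}^{4t} ) + (8t)^{4t} · Σ_k E ‖Y_k‖_{4t}^{4t}. -/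
open MeasureTheory ProbabilityTheory Matrix
open scoped BigOperators ENNReal

/-- The former Mathlib definition `Matrix.PosSemidef.sqrt` (at `𝕜 = ℝ`): the positive
semidefinite square root of a positive semidefinite matrix. -/
noncomputable def Matrix.PosSemidef.sqrt {n : Type*} [Fintype n] [DecidableEq n]
    {A : Matrix n n ℝ} (hA : A.PosSemidef) : Matrix n n ℝ :=
  hA.1.eigenvectorUnitary.1 * Matrix.diagonal ((fun x : ℝ => Real.sqrt x) ∘ hA.1.eigenvalues) *
    (star hA.1.eigenvectorUnitary : Matrix n n ℝ)

/-- The positive semidefinite square root of a positive semidefinite matrix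
(junk value `0` if the matrix is not positive semidefinite). -/
noncomputable def psdSqrt {m : Type*} [Fintype m] [DecidableEq m] (P : Matrix m m ℝ) :
    Matrix m m ℝ :=
  @dite _ P.PosSemidef (Classical.dec _) (fun h => h.sqrt) (fun _ => 0)


theorem sc_tangent (r x y : ℝ) (hr : 1 ≤ r) (hx : 0 ≤ x) (hy : 0 ≤ y) :
    x ^ r + r * x ^ (r-1) * (y - x) ≤ y ^ r := by
  rcases hx.eq_or_lt with rfl | hx
  · rw [Real.zero_rpow (by linarith)]
    rcases hr.eq_or_lt with rfl | hr
    · simp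
    · rw [Real.zero_rpow (by linarith)]; simp; positivity
  · have h := one_add_mul_self_le_rpow_one_add (s := y/x - 1) (by have := div_nonneg hy hx.le; linarith) hr
    have e : (1 + (y/x-1)) = y/x := by ring
    rw [e, Real.div_rpow hy hx.le, le_div_iff₀ (by positivity)] at h
    have : x ^ r = x ^ (r-1) * x := by
      rw [← Real.rpow_add_one hx.ne']; ring_nf
    have e2 : (1 + r * (y/x-1)) * x^r = x ^ r + r * x ^ (r-1) * (y - x) := by
      rw [this]; field_simp
    linarith

theorem sc_trap (q x y : ℝ) (hq : 2 ≤ q) (hy : 0 ≤ y) (hx : y ≤ x) :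
    x ^ q - y ^ q ≤ q / 2 * (x - y) * (x ^ (q-1) + y ^ (q-1)) := by
  set G : ℝ → ℝ := fun x => q / 2 * (x - y) * (x ^ (q-1) + y ^ (q-1)) - x ^ q with hG
  have hd : ∀ z, HasDerivAt G (q / 2 * (z ^ (q-1) + y ^ (q-1)) + q / 2 * (z - y) * ((q-1) * z ^ (q-1-1)) - q * z ^ (q-1)) z := by
    intro z
    have h1 := Real.hasDerivAt_rpow_const (x := z) (p := q-1) (Or.inr (by linarith))
    have h2 := Real.hasDerivAt_rpow_const (x := z) (p := q) (Or.inr (by linarith))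
    have h3 := ((hasDerivAt_id z).sub_const y).const_mul (q/2)
    exact ((h3.mul (h1.add_const (y ^ (q-1)))).sub h2).congr_deriv (by simp only [id, mul_one])
  have hm : MonotoneOn G (Set.Ici y) := by
    apply monotoneOn_of_deriv_nonneg (convex_Ici y)
    · exact fun z _ => (hd z).continuousAt.continuousWithinAt
    · exact fun z _ => (hd z).differentiableAt.differentiableWithinAt
    · intro z hz
      rw [interior_Ici] at hz
      rw [(hd z).deriv]
      have := sc_tangent (q-1) z y (by linarith) (hy.trans hz.le) hy
      nlinarith
  have := hm Set.self_mem_Ici hx hx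
  simp only [hG] at this
  linarith

theorem sc1 (q x y : ℝ) (hq : 2 ≤ q) :
    |(|x| ^ q - |y| ^ q)| ≤ q / 2 * |x - y| * (|x| ^ (q-1) + |y| ^ (q-1)) := by
  wlog h : |y| ≤ |x| generalizing x y
  · have := this y x (le_of_not_ge h)
    rw [abs_sub_comm, abs_sub_comm x y, add_comm (|x| ^ (q-1))]; exact this
  have h1 := sc_trap q _ _ hq (abs_nonneg y) h
  rw [abs_of_nonneg (sub_nonneg.2 (Real.rpow_le_rpow (abs_nonneg _) h (by linarith)))]
  refine h1.trans ?_
  gcongr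
  exact abs_sub_abs_le_abs_sub x y

theorem sc2 (q x y : ℝ) (hq : 2 ≤ q) :
    (x - y) * (x * |x| ^ q - y * |y| ^ q) ≤ (q + 1) * (x - y)^2 * (|x| ^ q + |y| ^ q) := by
  have h1 := sc1 q x y hq
  have e : (x - y) * (x * |x| ^ q - y * |y| ^ q) = (x-y)^2 * (|x|^q+|y|^q)/2 + (x^2-y^2) * (|x|^q-|y|^q)/2 := by ring
  have h2 : (x^2-y^2) * (|x|^q-|y|^q) ≤ (|x - y| * (|x|+|y|)) * (q / 2 * |x - y| * (|x| ^ (q-1) + |y| ^ (q-1))) := by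
    refine (le_abs_self _).trans ?_
    rw [abs_mul]
    gcongr
    rw [sq_sub_sq, abs_mul, mul_comm]
    gcongr
    exact abs_add_le _ _
  have a1 : ∀ u : ℝ, |u| ^ q = |u| * |u| ^ (q-1) := by
    intro u
    rw [mul_comm, ← Real.rpow_add_one' (abs_nonneg _) (by linarith)]; ring_nf
  have h3 : (|x|+|y|) * (|x| ^ (q-1) + |y| ^ (q-1)) ≤ 2 * (|x|^q+|y|^q) := by
    have : 0 ≤ (|x| - |y|) * (|x| ^ (q-1) - |y| ^ (q-1)) := by
      rcases le_total |x| |y| with h | h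
      · exact mul_nonneg_of_nonpos_of_nonpos (by linarith) (sub_nonpos.2 (Real.rpow_le_rpow (abs_nonneg _) h (by linarith)))
      · exact mul_nonneg (by linarith) (sub_nonneg.2 (Real.rpow_le_rpow (abs_nonneg _) h (by linarith)))
    rw [a1 x, a1 y]; nlinarith
  have h4 : (|x - y| * (|x|+|y|)) * (q / 2 * |x - y| * (|x| ^ (q-1) + |y| ^ (q-1))) ≤ q * (x-y)^2 * (|x|^q+|y|^q) := by
    have : 0 ≤ q/2 * (x-y)^2 := by positivity
    have h5 := mul_le_mul_of_nonneg_left h3 this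
    have : |x-y| * |x-y| = (x-y)^2 := by rw [abs_mul_abs_self]; ring
    calc _ = q/2 * (|x-y| * |x-y|) * ((|x|+|y|) * (|x| ^ (q-1) + |y| ^ (q-1))) := by ring
      _ ≤ _ := by rw [this]; linarith
  have h6 : 0 ≤ (x-y)^2 * (|x|^q+|y|^q) := by positivity
  have : 0 ≤ q * ((x-y)^2 * (|x|^q+|y|^q)) := by positivity
  rw [e]; linarith

theorem sc3 (q a b : ℝ) (hq : 2 ≤ q) (ha : 0 ≤ a) :
    a^2 * |b| ^ (q-2) ≤ 1/(4*q^2) * (a * |b|^q) + (2*q)^(q-2) * a^((q+2)/2) := by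
  have hb2 : |b|^q = |b|^(2:ℝ) * |b|^(q-2) := by
    rw [← Real.rpow_add_of_nonneg (abs_nonneg _) (by norm_num) (by linarith)]; ring_nf
  have : 0 ≤ 1/(4*q^2) * (a * |b|^q) := by positivity
  have : 0 ≤ (2*q)^(q-2) * a^((q+2)/2) := by positivity
  by_cases h : a ≤ 1/(4*q^2) * |b|^(2:ℝ)
  · have : a * a * |b|^(q-2) ≤ a * (1/(4*q^2) * |b|^(2:ℝ)) * |b|^(q-2) := by gcongr
    rw [hb2] at *
    nlinarith
  · have h1 : |b|^(2:ℝ) ≤ (2*q)^2 * a := by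
      push Not at h
      have : 0 < 4*q^2 := by positivity
      rw [one_div, inv_mul_lt_iff₀ this] at h
      linarith
    have h2 : |b|^(q-2) ≤ (2*q)^(q-2) * a^((q-2)/2) := by
      calc |b|^(q-2) = (|b|^(2:ℝ))^((q-2)/2) := by rw [← Real.rpow_mul (abs_nonneg _)]; ring_nf
        _ ≤ ((2*q)^2 * a)^((q-2)/2) := Real.rpow_le_rpow (by positivity) h1 (by linarith)
        _ = _ := by
          rw [Real.mul_rpow (by positivity) ha, ← Real.rpow_natCast, ← Real.rpow_mul (by positivity)]
          congr 2; push_cast; ring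
    have h3 : a^((q+2)/2) = a^2 * a^((q-2)/2) := by
      rw [← Real.rpow_natCast, ← Real.rpow_add_of_nonneg ha (by norm_num) (by linarith)]; congr 1; push_cast; ring
    have : a^2 * |b|^(q-2) ≤ a^2 * ((2*q)^(q-2) * a^((q-2)/2)) := by gcongr
    rw [h3] at *; nlinarith

theorem sc4 (q a b κ : ℝ) (hq : 2 ≤ q) (ha : 0 ≤ a) (hκ : 0 ≤ κ) :
    κ * (a * |b| ^ q) ≤ 1/2 * |b|^(q+2) + 1/2 * (2*κ)^((q+2)/2) * a^((q+2)/2) := by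
  have hb2 : |b|^(q+2) = |b|^(2:ℝ) * |b|^q := by
    rw [← Real.rpow_add_of_nonneg (abs_nonneg _) (by norm_num) (by linarith)]; ring_nf
  have : 0 ≤ |b|^(q+2) := by positivity
  have : 0 ≤ (2*κ)^((q+2)/2) * a^((q+2)/2) := by positivity
  by_cases h : κ * a ≤ 1/2 * |b|^(2:ℝ)
  · have : κ * a * |b|^q ≤ (1/2 * |b|^(2:ℝ)) * |b|^q := by gcongr
    rw [hb2] at *
    nlinarith
  · have h1 : |b|^(2:ℝ) ≤ 2 * κ * a := by
      push Not at h; linarith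
    have h2 : |b|^q ≤ (2*κ*a)^(q/2) := by
      calc |b|^q = (|b|^(2:ℝ))^(q/2) := by rw [← Real.rpow_mul (abs_nonneg _)]; ring_nf
        _ ≤ _ := Real.rpow_le_rpow (by positivity) h1 (by linarith)
    have h3 : (2*κ)^((q+2)/2) * a^((q+2)/2) = (2*κ*a) * (2*κ*a)^(q/2) := by
      rw [← Real.mul_rpow (by positivity) ha, mul_comm (2*κ*a), ← Real.rpow_add_one' (by positivity) (by linarith)]; congr 1; ring
    have : (κ * a) * |b|^q ≤ (κ * a) * (2*κ*a)^(q/2) := by gcongr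
    rw [mul_assoc (1/2 : ℝ), h3] at *
    nlinarith

theorem sc5 (q a s : ℝ) (hq : 2 ≤ q) (ha : 0 ≤ a) (hs : 0 ≤ s) :
    a ^ (q/2) * s ≤ q/(q+2) * a^((q+2)/2) + 2/(q+2) * s^((q+2)/2) := by
  have h := Real.geom_mean_le_arith_mean2_weighted (w₁ := q/(q+2)) (w₂ := 2/(q+2)) (p₁ := a^((q+2)/2)) (p₂ := s^((q+2)/2))
    (by positivity) (by positivity) (by positivity) (by positivity) (by field_simp)
  rw [← Real.rpow_mul ha, ← Real.rpow_mul hs] at h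
  have e1 : (q+2)/2 * (q/(q+2)) = q/2 := by field_simp
  have e2 : (q+2)/2 * (2/(q+2)) = 1 := by field_simp
  rwa [e1, e2, Real.rpow_one] at h


section spec
variable {n : Type*} [Fintype n] [DecidableEq n]

theorem sp_exists {A : Matrix n n ℝ} (hA : A.IsHermitian) :
    ∃ U : Matrix n n ℝ, Uᵀ * U = 1 ∧ U * Uᵀ = 1 ∧
      ∀ f : ℝ → ℝ, cfc f A = U * diagonal (fun i => f (hA.eigenvalues i)) * Uᵀ := by
  refine ⟨hA.eigenvectorUnitary.1, ?_, ?_, ?_⟩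
  · have := Unitary.coe_star_mul_self hA.eigenvectorUnitary
    rwa [star_eq_conjTranspose, conjTranspose_eq_transpose_of_trivial] at this
  · have := Unitary.coe_mul_star_self hA.eigenvectorUnitary
    rwa [Unitary.coe_star, star_eq_conjTranspose, conjTranspose_eq_transpose_of_trivial] at this
  · intro f
    rw [hA.cfc_eq, Matrix.IsHermitian.cfc, Unitary.conjStarAlgAut_apply,
      star_eq_conjTranspose, conjTranspose_eq_transpose_of_trivial]
    rfl

theorem sp_cfc_id {A : Matrix n n ℝ} (hA : A.IsHermitian) : cfc (fun x : ℝ => x) A = A :=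
  cfc_id' ℝ A hA.isSelfAdjoint

theorem sp_trace_diag (M : Matrix n n ℝ) (U : Matrix n n ℝ) (w : n → ℝ) :
    (M * (U * diagonal w * Uᵀ)).trace = ∑ i, w i * (Uᵀ * M * U) i i := by
  rw [← mul_assoc, trace_mul_comm, ← mul_assoc, ← mul_assoc, trace]
  simp only [diag_apply, mul_diagonal]
  exact Finset.sum_congr rfl fun i _ => mul_comm _ _

theorem sp_a (C D U V : Matrix n n ℝ) (hV : V * Vᵀ = 1) (w : n → ℝ) :
    ∑ i, ∑ j, w i * ((Uᵀ * C * V) i j * (Uᵀ * D * V) i j)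
      = (C * Dᵀ * (U * diagonal w * Uᵀ)).trace := by
  rw [sp_trace_diag]
  refine Finset.sum_congr rfl fun i _ => ?_
  rw [← Finset.mul_sum]
  congr 1
  have : Uᵀ * (C * Dᵀ) * U = (Uᵀ * C * V) * (Uᵀ * D * V)ᵀ := by
    simp only [transpose_mul, transpose_transpose]
    rw [show Uᵀ * C * V * (Vᵀ * (Dᵀ * U)) = Uᵀ * C * (V * Vᵀ) * (Dᵀ * U) by simp only [mul_assoc], hV]
    simp only [mul_assoc, mul_one]
  rw [this, mul_apply]
  rfl

theorem sp_b (C D U V : Matrix n n ℝ) (hU : U * Uᵀ = 1) (w : n → ℝ) :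
    ∑ i, ∑ j, w j * ((Uᵀ * C * V) i j * (Uᵀ * D * V) i j)
      = (Cᵀ * D * (V * diagonal w * Vᵀ)).trace := by
  have h := sp_a Cᵀ Dᵀ V U hU w
  rw [transpose_transpose] at h
  rw [← h, Finset.sum_comm]
  refine Finset.sum_congr rfl fun i _ => Finset.sum_congr rfl fun j _ => ?_
  rw [show Vᵀ * Cᵀ * U = (Uᵀ * C * V)ᵀ by simp [mul_assoc], show Vᵀ * Dᵀ * U = (Uᵀ * D * V)ᵀ by simp [mul_assoc]]
  rfl

/-- joint spectral comparison -/
theorem sp_joint {A B : Matrix n n ℝ} (hA : A.IsHermitian) (hB : B.IsHermitian) :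
    ∃ c : n → n → ℝ, (∀ i j, 0 ≤ c i j) ∧ ∀ f g : ℝ → ℝ,
      (cfc f A * cfc g B).trace = ∑ i, ∑ j, f (hA.eigenvalues i) * g (hB.eigenvalues j) * c i j := by
  obtain ⟨U, hU1, hU2, hU⟩ := sp_exists hA
  obtain ⟨V, hV1, hV2, hV⟩ := sp_exists hB
  refine ⟨fun i j => (Uᵀ * V) i j ^ 2, fun i j => sq_nonneg _, fun f g => ?_⟩
  rw [trace_mul_comm]
  have h := sp_a (cfc g B) 1 U V hV2 (fun i => f (hA.eigenvalues i))
  rw [← hU f, transpose_one, mul_one, mul_one] at h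
  rw [← h]
  refine Finset.sum_congr rfl fun i _ => Finset.sum_congr rfl fun j _ => ?_
  rw [hV g, show Uᵀ * (V * diagonal (fun i => g (hB.eigenvalues i)) * Vᵀ) * V = Uᵀ * V * diagonal (fun i => g (hB.eigenvalues i)) * (Vᵀ * V) by simp only [mul_assoc], hV1, mul_one, mul_diagonal]
  ring

theorem sp_diff {A B : Matrix n n ℝ} (hA : A.IsHermitian) (hB : B.IsHermitian) :
    ∃ U V : Matrix n n ℝ, 
      (∀ (C : Matrix n n ℝ) (f : ℝ → ℝ), (C * cfc f A).trace - (C * cfc f B).trace =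
         ∑ i, ∑ j, (f (hA.eigenvalues i) - f (hB.eigenvalues j)) * ((Uᵀ * C * V) i j * (Uᵀ * V) i j)) ∧
      (∀ i j, (Uᵀ * (A - B) * V) i j = (hA.eigenvalues i - hB.eigenvalues j) * (Uᵀ * V) i j) ∧
      (∀ (C : Matrix n n ℝ) (f : ℝ → ℝ), C.IsHermitian → (C * C * cfc f A).trace = 
        ∑ i, ∑ j, f (hA.eigenvalues i) * ((Uᵀ * C * V) i j)^2) ∧
      (∀ (C : Matrix n n ℝ) (f : ℝ → ℝ), C.IsHermitian → (C * C * cfc f B).trace = 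
        ∑ i, ∑ j, f (hB.eigenvalues j) * ((Uᵀ * C * V) i j)^2) := by
  obtain ⟨U, hU1, hU2, hU⟩ := sp_exists hA
  obtain ⟨V, hV1, hV2, hV⟩ := sp_exists hB
  refine ⟨U, V, ?_, ?_, ?_, ?_⟩
  · intro C f
    have h1 := sp_a C 1 U V hV2 (fun i => f (hA.eigenvalues i))
    have h2 := sp_b 1 C U V hU2 (fun i => f (hB.eigenvalues i))
    rw [← hU f, transpose_one, mul_one, mul_one] at h1
    rw [← hV f, transpose_one, one_mul, mul_one] at h2
    rw [← h1, ← h2, ← Finset.sum_sub_distrib]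
    refine Finset.sum_congr rfl fun i _ => ?_
    rw [← Finset.sum_sub_distrib]
    refine Finset.sum_congr rfl fun j _ => ?_
    ring
  · intro i j
    have e1 := hU (fun x => x)
    have e2 := hV (fun x => x)
    rw [sp_cfc_id hA] at e1
    rw [sp_cfc_id hB] at e2
    have e3 : Uᵀ * A = diagonal hA.eigenvalues * Uᵀ := by
      conv_lhs => rw [e1]
      rw [← mul_assoc, ← mul_assoc, hU1, one_mul]
    have e4 : B * V = V * diagonal hB.eigenvalues := by
      conv_lhs => rw [e2]
      rw [mul_assoc, hV1, mul_one]
    rw [mul_sub, sub_mul, e3, mul_assoc Uᵀ B V, e4, mul_assoc, ← mul_assoc Uᵀ V, Matrix.sub_apply, diagonal_mul, mul_diagonal]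
    ring
  · intro C f hC
    have h1 := sp_a C C U V hV2 (fun i => f (hA.eigenvalues i))
    have hC' : Cᵀ = C := by rw [← conjTranspose_eq_transpose_of_trivial]; exact hC
    rw [← hU f, hC'] at h1
    rw [← h1]
    simp only [sq]
  · intro C f hC
    have h1 := sp_b C C U V hU2 (fun i => f (hB.eigenvalues i))
    have hC' : Cᵀ = C := by rw [← conjTranspose_eq_transpose_of_trivial]; exact hC
    rw [← hV f, hC'] at h1
    rw [← h1]
    simp only [sq]

/-- `|A|^r` -/
noncomputable def pw (r : ℝ) (A : Matrix n n ℝ) : Matrix n n ℝ := cfc (fun x : ℝ => |x| ^ r) A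

/-- `A|A|^r` -/
noncomputable def hw (r : ℝ) (A : Matrix n n ℝ) : Matrix n n ℝ := cfc (fun x : ℝ => x * |x| ^ r) A

theorem mat1 (q : ℝ) (hq : 2 ≤ q) {A B C : Matrix n n ℝ} (hA : A.IsHermitian) (hB : B.IsHermitian) (hC : C.IsHermitian) :
    |(C * pw q A).trace - (C * pw q B).trace| ≤
      q^2/2 * ((C * C * pw (q-2) A).trace + (C * C * pw (q-2) B).trace)
      + 1/8 * (((A-B) * (A-B) * pw q A).trace + ((A-B) * (A-B) * pw q B).trace) := by
  obtain ⟨U, V, h1, h2, h3, h4⟩ := sp_diff hA hB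
  unfold pw
  rw [h1, h3 C _ hC, h4 C _ hC, h3 (A-B) _ (hA.sub hB), h4 (A-B) _ (hA.sub hB)]
  refine (Finset.abs_sum_le_sum_abs _ _).trans ?_
  simp only [Finset.mul_sum, ← Finset.sum_add_distrib]
  refine Finset.sum_le_sum fun i _ => ?_
  refine (Finset.abs_sum_le_sum_abs _ _).trans ?_
  refine Finset.sum_le_sum fun j _ => ?_
  rw [h2]
  generalize hA.eigenvalues i = x
  generalize hB.eigenvalues j = y
  generalize (Uᵀ * C * V) i j = c
  generalize (Uᵀ * V) i j = e
  rw [abs_mul, abs_mul]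
  have key : ∀ z : ℝ, q/2 * (|z|^(q-1) * (|c| * |(x-y)*e|)) ≤ q^2/2 * (|z|^(q-2) * c^2) + 1/8 * (|z|^q * ((x-y)*e)^2) := by
    intro z
    have k1 : |z|^(q-1) = |z|^(q-2) * |z| := by
      rw [← Real.rpow_add_one' (abs_nonneg _) (by linarith)]; ring_nf
    have k2 : |z|^q = |z|^(q-2) * |z|^2 := by
      rw [← Real.rpow_natCast, ← Real.rpow_add_of_nonneg (abs_nonneg _) (by linarith) (by norm_num)]; norm_num
    rw [k1, k2, ← sq_abs c, ← sq_abs ((x-y)*e)]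
    have : 0 ≤ |z|^(q-2) := by positivity
    have := mul_nonneg this (sq_nonneg (2*q*|c| - |z| * |(x-y)*e|))
    nlinarith
  have h5 := mul_le_mul_of_nonneg_right (sc1 q x y hq) (mul_nonneg (abs_nonneg c) (abs_nonneg e))
  have kx := key x
  have ky := key y
  refine h5.trans ?_
  rw [abs_mul] at kx ky
  linarith

theorem mat0 (q : ℝ) (hq : 2 ≤ q) {A B : Matrix n n ℝ} (hA : A.IsHermitian) (hB : B.IsHermitian) :
    ((A - B) * hw q A).trace - ((A-B) * hw q B).trace ≤
      (q+1) * (((A-B) * (A-B) * pw q A).trace + ((A-B) * (A-B) * pw q B).trace) := by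
  obtain ⟨U, V, h1, h2, h3, h4⟩ := sp_diff hA hB
  unfold pw hw
  rw [h1, h3 (A-B) _ (hA.sub hB), h4 (A-B) _ (hA.sub hB)]
  simp only [Finset.mul_sum, ← Finset.sum_add_distrib]
  refine Finset.sum_le_sum fun i _ => ?_
  refine Finset.sum_le_sum fun j _ => ?_
  rw [h2]
  generalize hA.eigenvalues i = x
  generalize hB.eigenvalues j = y
  generalize (Uᵀ * V) i j = e
  have h5 := mul_le_mul_of_nonneg_right (sc2 q x y hq) (sq_nonneg e)
  linarith

theorem cfc_one' (A : Matrix n n ℝ) (hA : A.IsHermitian) : cfc (fun _ : ℝ => (1:ℝ)) A = 1 := 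
  cfc_const_one ℝ A hA.isSelfAdjoint

theorem cfc_sq' {A : Matrix n n ℝ} (hA : A.IsHermitian) : cfc (fun x : ℝ => x^2) A = A * A := by
  rw [cfc_pow_id (R := ℝ) A 2 hA.isSelfAdjoint, sq]

theorem mat2 (q : ℝ) (hq : 2 ≤ q) {P A : Matrix n n ℝ} (hP : P.PosSemidef) (hA : A.IsHermitian) :
    (P * P * pw (q-2) A).trace ≤ 1/(4*q^2) * (P * pw q A).trace + (2*q)^(q-2) * (pw ((q+2)/2) P).trace := by
  obtain ⟨c, hc, h⟩ := sp_joint hP.1 hA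
  have e1 := h (fun x => x^2) (fun x => |x|^(q-2))
  have e2 := h (fun x => x) (fun x => |x|^q)
  have e3 := h (fun x => |x|^((q+2)/2)) (fun x => 1)
  rw [cfc_sq' hP.1] at e1
  rw [sp_cfc_id hP.1] at e2
  rw [cfc_one' A hA, mul_one] at e3
  unfold pw
  rw [e1, e2, e3]
  simp only [Finset.mul_sum, ← Finset.sum_add_distrib]
  refine Finset.sum_le_sum fun i _ => Finset.sum_le_sum fun j _ => ?_
  have := mul_le_mul_of_nonneg_right (sc3 q _ (hA.eigenvalues j) hq (hP.eigenvalues_nonneg i)) (hc i j)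
  rw [abs_of_nonneg (hP.eigenvalues_nonneg i)]
  linarith

theorem mat4 (q κ : ℝ) (hq : 2 ≤ q) (hκ : 0 ≤ κ) {P A : Matrix n n ℝ} (hP : P.PosSemidef) (hA : A.IsHermitian) :
    κ * (P * pw q A).trace ≤ 1/2 * (pw (q+2) A).trace + 1/2 * (2*κ)^((q+2)/2) * (pw ((q+2)/2) P).trace := by
  obtain ⟨c, hc, h⟩ := sp_joint hP.1 hA
  have e1 := h (fun x => 1) (fun x => |x|^(q+2))
  have e2 := h (fun x => x) (fun x => |x|^q)
  have e3 := h (fun x => |x|^((q+2)/2)) (fun x => 1)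
  rw [cfc_one' P hP.1, one_mul] at e1
  rw [sp_cfc_id hP.1] at e2
  rw [cfc_one' A hA, mul_one] at e3
  unfold pw
  rw [e1, e2, e3]
  simp only [Finset.mul_sum, ← Finset.sum_add_distrib]
  refine Finset.sum_le_sum fun i _ => Finset.sum_le_sum fun j _ => ?_
  have := mul_le_mul_of_nonneg_right (sc4 q _ (hA.eigenvalues j) κ hq (hP.eigenvalues_nonneg i) hκ) (hc i j)
  rw [abs_of_nonneg (hP.eigenvalues_nonneg i)]
  linarith

theorem mat5 (q : ℝ) (hq : 2 ≤ q) {P S : Matrix n n ℝ} (hP : P.PosSemidef) (hS : S.PosSemidef) :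
    (pw (q/2) P * S).trace ≤ q/(q+2) * (pw ((q+2)/2) P).trace + 2/(q+2) * (pw ((q+2)/2) S).trace := by
  obtain ⟨c, hc, h⟩ := sp_joint hP.1 hS.1
  have e1 := h (fun x => 1) (fun x => |x|^((q+2)/2))
  have e2 := h (fun x => |x|^(q/2)) (fun x => x)
  have e3 := h (fun x => |x|^((q+2)/2)) (fun x => 1)
  rw [cfc_one' P hP.1, one_mul] at e1
  rw [sp_cfc_id hS.1] at e2
  rw [cfc_one' S hS.1, mul_one] at e3
  unfold pw
  rw [e1, e2, e3]
  simp only [Finset.mul_sum, ← Finset.sum_add_distrib]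
  refine Finset.sum_le_sum fun i _ => Finset.sum_le_sum fun j _ => ?_
  have := mul_le_mul_of_nonneg_right (sc5 q _ _ hq (hP.eigenvalues_nonneg i) (hS.eigenvalues_nonneg j)) (hc i j)
  rw [abs_of_nonneg (hP.eigenvalues_nonneg i), abs_of_nonneg (hS.eigenvalues_nonneg j)]
  linarith

theorem mat3 (q : ℝ) (hq : 2 ≤ q) {A B P : Matrix n n ℝ} (hA : A.IsHermitian) (hB : B.IsHermitian) (hP : P.PosSemidef) :
    |(P * pw q A).trace - (P * pw q B).trace| ≤
      1/8 * ((P * pw q A).trace + (P * pw q B).trace) + q^2 * (2*q)^(q-2) * (pw ((q+2)/2) P).trace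
      + 1/8 * (((A-B) * (A-B) * pw q A).trace + ((A-B) * (A-B) * pw q B).trace) := by
  refine (mat1 q hq hA hB hP.1).trans ?_
  have h1 := mat2 q hq hP hA
  have h2 := mat2 q hq hP hB
  have h3 := mul_le_mul_of_nonneg_left (add_le_add h1 h2) (by positivity : 0 ≤ q^2/2)
  have e : q^2/2 * (1/(4*q^2)) = 1/8 := by field_simp; norm_num
  have : ∀ a b c d T: ℝ, q^2/2 * (1/(4*q^2) * a + c * T + (1/(4*q^2) * b + c * T)) = 1/8 * (a + b) + q^2 * c * T := by
    intro a b c d T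
    rw [← e]; ring
  rw [this _ _ _ 0] at h3
  linarith

/-- trace of `|A|^r` as a sum over eigenvalues -/
theorem tr_cfc {A : Matrix n n ℝ} (hA : A.IsHermitian) (f : ℝ → ℝ) :
    (cfc f A).trace = ∑ i, f (hA.eigenvalues i) := by
  obtain ⟨U, hU1, hU2, hU⟩ := sp_exists hA
  have := sp_trace_diag 1 U (fun i => f (hA.eigenvalues i))
  rw [one_mul, ← hU f] at this
  rw [this]; simp [hU1]

theorem pw_sq {A : Matrix n n ℝ} (hA : A.IsHermitian) (r : ℝ) :
    pw (r/2) (A * A) = pw r A := by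
  unfold pw
  rw [← cfc_sq' hA, ← cfc_comp' (fun x : ℝ => |x|^(r/2)) (fun x => x^2) A 
    (by apply Set.Finite.continuousOn; exact (Matrix.finite_real_spectrum (A := A)).image _)]
  congr 1
  ext x
  rw [abs_of_nonneg (sq_nonneg x), ← sq_abs, ← Real.rpow_natCast, ← Real.rpow_mul (abs_nonneg _)]
  congr 1; push_cast; ring

theorem mul_hw {A : Matrix n n ℝ} (hA : A.IsHermitian) (q : ℝ) (hq : 2 ≤ q) :
    A * hw q A = pw (q+2) A := by
  unfold hw pw
  conv_lhs => rw [← cfc_id' ℝ A hA.isSelfAdjoint]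
  conv_lhs => enter [2]; rw [cfc_id' ℝ A hA.isSelfAdjoint]
  rw [← cfc_mul (fun x : ℝ => x) (fun x : ℝ => x * |x| ^ q) A (Matrix.finite_real_spectrum.continuousOn _) (Matrix.finite_real_spectrum.continuousOn _)]
  congr 1
  ext x
  rw [Real.rpow_add' (abs_nonneg _) (by linarith)]
  norm_num
  ring

theorem pw_mul_self {P : Matrix n n ℝ} (hP : P.PosSemidef) (q : ℝ) (hq : 2 ≤ q) :
    (pw (q/2) P * P).trace = (pw ((q+2)/2) P).trace := by
  obtain ⟨c, hc, h⟩ := sp_joint hP.1 hP.1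
  unfold pw
  conv_lhs => enter [1, 2]; rw [← cfc_id' ℝ P hP.1.isSelfAdjoint]
  rw [← cfc_mul _ (fun x : ℝ => x) P (Matrix.finite_real_spectrum.continuousOn _) (Matrix.finite_real_spectrum.continuousOn _), tr_cfc hP.1, tr_cfc hP.1]
  refine Finset.sum_congr rfl fun i _ => ?_
  have := hP.eigenvalues_nonneg i
  rw [abs_of_nonneg this, ← Real.rpow_add_one' this (by linarith)]
  congr 1; ring
end spec


section meas
variable {n : Type*} [Fintype n] [DecidableEq n]

theorem sp_entry {A : Matrix n n ℝ} (hA : A.IsHermitian) :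
    ∃ U : Matrix n n ℝ, (∀ i l, |U i l| ≤ 1) ∧ (∀ f : ℝ → ℝ, ∀ i j, cfc f A i j = ∑ l, U i l * f (hA.eigenvalues l) * U j l)
     ∧ ∀ l, hA.eigenvalues l = ∑ i, ∑ j, U i l * A i j * U j l := by
  obtain ⟨U, hU1, hU2, hU⟩ := sp_exists hA
  refine ⟨U, ?_, ?_, ?_⟩
  · intro i l
    have : (U * Uᵀ) i i = 1 := by rw [hU2]; simp
    rw [mul_apply] at this
    simp only [transpose_apply] at this
    have h2 : U i l * U i l ≤ 1 := by
      rw [← this]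
      exact Finset.single_le_sum (f := fun j => U i j * U i j) (fun j _ => mul_self_nonneg _) (Finset.mem_univ l)
    rw [abs_le]; constructor <;> nlinarith
  · intro f i j
    rw [hU, mul_apply]
    simp [mul_diagonal]
  · intro l
    have e1 := hU (fun x => x)
    rw [sp_cfc_id hA] at e1
    have e3 : Uᵀ * A * U = diagonal hA.eigenvalues := by
      conv_lhs => rw [e1]
      rw [show Uᵀ * (U * diagonal (fun i => hA.eigenvalues i) * Uᵀ) * U = (Uᵀ * U) * diagonal (fun i => hA.eigenvalues i) * (Uᵀ * U) by simp only [mul_assoc], hU1]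
      simp
    have e4 : (Uᵀ * A * U) l l = hA.eigenvalues l := by rw [e3]; simp
    rw [← e4, mul_apply]
    simp only [mul_apply, transpose_apply, Finset.sum_mul]
    rw [Finset.sum_comm]

/-- entrywise one-norm -/
noncomputable def eN (A : Matrix n n ℝ) : ℝ := ∑ i, ∑ j, |A i j|

theorem eN_nonneg (A : Matrix n n ℝ) : 0 ≤ eN A := by unfold eN; positivity

theorem eig_le {A : Matrix n n ℝ} (hA : A.IsHermitian) (l : n) : |hA.eigenvalues l| ≤ eN A := by
  obtain ⟨U, h1, h2, h3⟩ := sp_entry hA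
  rw [h3]
  refine (Finset.abs_sum_le_sum_abs _ _).trans (Finset.sum_le_sum fun i _ => (Finset.abs_sum_le_sum_abs _ _).trans (Finset.sum_le_sum fun j _ => ?_))
  rw [abs_mul, abs_mul]
  have := h1 i l; have := h1 j l
  calc _ ≤ 1 * |A i j| * 1 := by gcongr
    _ = _ := by ring

theorem cfc_entry_le {A : Matrix n n ℝ} (hA : A.IsHermitian) (f : ℝ → ℝ) (i j : n) :
    |cfc f A i j| ≤ ∑ l, |f (hA.eigenvalues l)| := by
  obtain ⟨U, h1, h2, h3⟩ := sp_entry hA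
  rw [h2]
  refine (Finset.abs_sum_le_sum_abs _ _).trans (Finset.sum_le_sum fun l _ => ?_)
  rw [abs_mul, abs_mul]
  have := h1 i l; have := h1 j l
  calc _ ≤ 1 * |f (hA.eigenvalues l)| * 1 := by gcongr
    _ = _ := by ring

theorem cfc_entry_le' {A : Matrix n n ℝ} (hA : A.IsHermitian) (f : ℝ → ℝ) (b : ℝ) (hb : 0 ≤ b)
    (hf : ∀ x, |f x| ≤ |x| ^ b) (Z : ℝ) (hZ : eN A ≤ Z) (i j : n) :
    |cfc f A i j| ≤ Fintype.card n * Z ^ b := by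
  refine (cfc_entry_le hA f i j).trans ?_
  have : ∑ l : n, |f (hA.eigenvalues l)| ≤ ∑ l : n, Z ^ b := by
    refine Finset.sum_le_sum fun l _ => (hf _).trans ?_
    exact Real.rpow_le_rpow (abs_nonneg _) ((eig_le hA l).trans hZ) hb
  simpa using this

theorem entry_pow_le {A : Matrix n n ℝ} (hA : A.IsHermitian) (p : ℝ) (hp : 0 < p) (i j : n) :
    |A i j| ^ p ≤ (Fintype.card n : ℝ) ^ p * (pw p A).trace := by
  have h := cfc_entry_le hA (fun x => x) i j
  rw [sp_cfc_id hA] at h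
  unfold pw
  rw [tr_cfc hA]
  set T := ∑ i, |hA.eigenvalues i| ^ p
  have hT : 0 ≤ T := by positivity
  have h2 : ∑ l, |hA.eigenvalues l| ≤ Fintype.card n * T ^ (1/p) := by
    have : ∑ l, |hA.eigenvalues l| ≤ ∑ l : n, T ^ (1/p) := by
      refine Finset.sum_le_sum fun l _ => ?_
      have : |hA.eigenvalues l| ^ p ≤ T := Finset.single_le_sum (f := fun l => |hA.eigenvalues l| ^ p) (fun j _ => by positivity) (Finset.mem_univ l)
      have h3 := Real.rpow_le_rpow (by positivity) this (by positivity : 0 ≤ 1/p)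
      rwa [← Real.rpow_mul (abs_nonneg _), mul_one_div_cancel hp.ne', Real.rpow_one] at h3
    simpa using this
  calc |A i j| ^ p ≤ (Fintype.card n * T ^ (1/p)) ^ p := Real.rpow_le_rpow (abs_nonneg _) (h.trans h2) hp.le
    _ = _ := by
      rw [Real.mul_rpow (by positivity) (by positivity), ← Real.rpow_mul hT, one_div_mul_cancel hp.ne', Real.rpow_one]

theorem meas_pow {α : Type*} [MeasurableSpace α] (A : α → Matrix n n ℝ) (hm : ∀ i j, Measurable fun ω => A ω i j) (k : ℕ) :
    ∀ i j, Measurable fun ω => (A ω ^ k) i j := by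
  induction k with
  | zero => intro i j; simp
  | succ k ih =>
    intro i j
    simp only [pow_succ, mul_apply]
    exact Finset.measurable_sum _ fun l _ => (ih i l).mul (hm l j)

theorem meas_cfc {α : Type*} [MeasurableSpace α] (A : α → Matrix n n ℝ) (hA : ∀ ω, (A ω).IsHermitian)
    (hm : ∀ i j, Measurable fun ω => A ω i j) (f : ℝ → ℝ) (hf : Continuous f) (i j : n) :
    Measurable fun ω => cfc f (A ω) i j := by
  have hpoly : ∀ m : ℕ, ∃ p : Polynomial ℝ, ∀ x ∈ Set.Icc (-(m:ℝ)) m, |p.eval x - f x| < 1/((m:ℝ)+1) := fun m =>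
    exists_polynomial_near_of_continuousOn _ _ f hf.continuousOn _ (by positivity)
  choose P hP using hpoly
  have hlim : ∀ x, Filter.Tendsto (fun m => (P m).eval x) Filter.atTop (nhds (f x)) := by
    intro x
    rw [tendsto_iff_dist_tendsto_zero]
    refine squeeze_zero' (Filter.Eventually.of_forall fun _ => dist_nonneg) ?_ tendsto_one_div_add_atTop_nhds_zero_nat
    filter_upwards [Filter.eventually_ge_atTop ⌈|x|⌉₊] with m hm
    have h1 : |x| ≤ m := (Nat.le_ceil _).trans (by exact_mod_cast hm)
    exact (hP m x (abs_le.1 h1)).le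
  refine measurable_of_tendsto_metrizable (f := fun m ω => cfc (P m).eval (A ω) i j) ?_ ?_
  · intro m
    have : (fun ω => cfc (P m).eval (A ω) i j) = fun ω => ∑ k ∈ (P m).support, (P m).coeff k * (A ω ^ k) i j := by
      ext ω
      rw [cfc_polynomial (P m) (A ω) (hA ω).isSelfAdjoint, Polynomial.aeval_eq_sum_range' (Nat.lt_succ_self _), Matrix.sum_apply]
      rw [← Polynomial.sum_def (P m) (fun k c => c * (A ω ^ k) i j), Polynomial.sum_over_range _ (by simp)]
      simp
    rw [this]
    exact Finset.measurable_sum _ fun k _ => (meas_pow A hm k i j).const_mul _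
  · rw [tendsto_pi_nhds]
    intro ω
    obtain ⟨U, h1, h2, h3⟩ := sp_entry (hA ω)
    simp only [h2]
    refine tendsto_finsetSum _ fun l _ => ?_
    exact ((hlim _).const_mul _).mul_const _

variable {Ω : Type*} [MeasurableSpace Ω] {μ : Measure Ω}

theorem integ_entry (C A : Ω → Matrix n n ℝ) (Z : Ω → ℝ) (a b c : ℝ) (hb : 0 ≤ b) (f : ℝ → ℝ)
    (hf : Continuous f) (hfb : ∀ x, |f x| ≤ |x| ^ b) (hZ1 : ∀ ω, 1 ≤ Z ω) (hZ : Integrable (fun ω => Z ω ^ (a+b)) μ)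
    (hC : ∀ i j, Measurable fun ω => C ω i j) (hA : ∀ i j, Measurable fun ω => A ω i j)
    (hAh : ∀ ω, (A ω).IsHermitian) (hAZ : ∀ ω, eN (A ω) ≤ Z ω) (hCZ : ∀ ω i j, |C ω i j| ≤ c * Z ω ^ a) (i j k l : n) :
    Integrable (fun ω => C ω i j * cfc f (A ω) k l) μ := by
  refine (hZ.const_mul (c * Fintype.card n)).mono' ((hC i j).mul (meas_cfc A hAh hA f hf k l)).aestronglyMeasurable ?_
  refine Filter.Eventually.of_forall fun ω => ?_
  rw [Real.norm_eq_abs, abs_mul, Real.rpow_add (by linarith [hZ1 ω])]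
  have h1 := cfc_entry_le' (hAh ω) f b hb hfb _ (hAZ ω) k l
  calc _ ≤ (c * Z ω ^ a) * (Fintype.card n * Z ω ^ b) := mul_le_mul (hCZ ω i j) h1 (abs_nonneg _) ((abs_nonneg _).trans (hCZ ω i j))
    _ = _ := by ring

theorem integ_tr (C A : Ω → Matrix n n ℝ) (Z : Ω → ℝ) (a b c : ℝ) (hb : 0 ≤ b) (f : ℝ → ℝ)
    (hf : Continuous f) (hfb : ∀ x, |f x| ≤ |x| ^ b) (hZ1 : ∀ ω, 1 ≤ Z ω) (hZ : Integrable (fun ω => Z ω ^ (a+b)) μ)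
    (hC : ∀ i j, Measurable fun ω => C ω i j) (hA : ∀ i j, Measurable fun ω => A ω i j)
    (hAh : ∀ ω, (A ω).IsHermitian) (hAZ : ∀ ω, eN (A ω) ≤ Z ω) (hCZ : ∀ ω i j, |C ω i j| ≤ c * Z ω ^ a) :
    Integrable (fun ω => (C ω * cfc f (A ω)).trace) μ := by
  simp only [trace, diag_apply, mul_apply]
  exact integrable_finsetSum _ fun i _ => integrable_finsetSum _ fun j _ => 
    integ_entry C A Z a b c hb f hf hfb hZ1 hZ hC hA hAh hAZ hCZ i j j i

theorem indep_tr (C G : Ω → Matrix n n ℝ) (hC : ∀ i j, Measurable fun ω => C ω i j) (hG : ∀ i j, Measurable fun ω => G ω i j)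
    (hi : ∀ i j k l, IndepFun (fun ω => C ω i j) (fun ω => G ω k l) μ)
    (hint : ∀ i j, Integrable (fun ω => C ω i j * G ω j i) μ) (hG' : ∀ i j, Integrable (fun ω => G ω i j) μ) :
    ∫ ω, (C ω * G ω).trace ∂μ = ∫ ω, (matIntegral μ C * G ω).trace ∂μ := by
  have key : ∀ C' : Ω → Matrix n n ℝ, (∀ i j, Integrable (fun ω => C' ω i j * G ω j i) μ) →
      ∫ ω, (C' ω * G ω).trace ∂μ = ∑ i, ∑ j, ∫ ω, C' ω i j * G ω j i ∂μ := by
    intro C' h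
    simp only [trace, diag_apply, mul_apply]
    rw [integral_finsetSum _ fun i _ => integrable_finsetSum _ fun j _ => h i j]
    refine Finset.sum_congr rfl fun i _ => ?_
    rw [integral_finsetSum _ fun j _ => h i j]
  rw [key C hint, key (fun _ => matIntegral μ C) (fun i j => (hG' j i).const_mul _)]
  refine Finset.sum_congr rfl fun i _ => Finset.sum_congr rfl fun j _ => ?_
  rw [integral_const_mul]
  exact (hi i j j i).integral_mul_eq_mul_integral (hC i j).aestronglyMeasurable (hG j i).aestronglyMeasurable

theorem int_comb (f1 f2 f3 f4 f5 : Ω → ℝ) (c1 c2 c3 c4 c5 c : ℝ) [IsProbabilityMeasure μ]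
   (h1 : Integrable f1 μ) (h2 : Integrable f2 μ) (h3 : Integrable f3 μ) (h4 : Integrable f4 μ) (h5 : Integrable f5 μ)
   (h : ∀ ω, 0 ≤ c1 * f1 ω + c2 * f2 ω + c3 * f3 ω + c4 * f4 ω + c5 * f5 ω + c) :
   0 ≤ c1 * ∫ ω, f1 ω ∂μ + c2 * ∫ ω, f2 ω ∂μ + c3 * ∫ ω, f3 ω ∂μ + c4 * ∫ ω, f4 ω ∂μ + c5 * ∫ ω, f5 ω ∂μ + c := by
  have := integral_nonneg_of_ae (μ := μ) (Filter.Eventually.of_forall h)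
  have i1 := h1.const_mul c1
  have i2 := h2.const_mul c2
  have i3 := h3.const_mul c3
  have i4 := h4.const_mul c4
  have i5 := h5.const_mul c5
  have e : ∫ ω, (c1 * f1 ω + c2 * f2 ω + c3 * f3 ω + c4 * f4 ω + c5 * f5 ω + c) ∂μ = c1 * ∫ ω, f1 ω ∂μ + c2 * ∫ ω, f2 ω ∂μ + c3 * ∫ ω, f3 ω ∂μ + c4 * ∫ ω, f4 ω ∂μ + c5 * ∫ ω, f5 ω ∂μ + c := by
    rw [integral_add (by fun_prop) (by fun_prop), integral_add (by fun_prop) (by fun_prop), integral_add (by fun_prop) (by fun_prop),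
      integral_add (by fun_prop) (by fun_prop), integral_add i1 i2]
    simp only [integral_const_mul, integral_const, probReal_univ, one_smul]
  rw [← e]; exact this

end meas


section herm
variable {n : Type*} [Fintype n] [DecidableEq n]
variable {Ω : Type*} [MeasurableSpace Ω] {μ : Measure Ω}

theorem entry_le_eN (A : Matrix n n ℝ) (i j : n) : |A i j| ≤ eN A := by
  unfold eN
  refine le_trans ?_ (Finset.single_le_sum (f := fun i => ∑ j, |A i j|) (fun j _ => by positivity) (Finset.mem_univ i))
  exact Finset.single_le_sum (f := fun j => |A i j|) (fun j _ => by positivity) (Finset.mem_univ j)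

theorem indep_cfc (C B : Ω → Matrix n n ℝ) (hBh : ∀ ω, (B ω).IsHermitian)
    (h : IndepFun (fun ω i j => C ω i j) (fun ω i j => B ω i j) μ) (φ : (n → n → ℝ) → ℝ) (hφ : Measurable φ)
    (f : ℝ → ℝ) (hf : Continuous f) (k l : n) : IndepFun (fun ω => φ (fun i j => C ω i j)) (fun ω => cfc f (B ω) k l) μ := by
  let S : (n → n → ℝ) → Matrix n n ℝ := fun M => Matrix.of fun i j => (M i j + M j i) / 2
  have hS : ∀ M, (S M).IsHermitian := by
    intro M
    ext i j
    simp [S, add_comm]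
  have hm : ∀ i j, Measurable fun M => S M i j := by
    intro i j
    simp only [S, Matrix.of_apply]
    fun_prop
  have := h.comp hφ (meas_cfc S hS hm f hf k l)
  have hSB : ∀ ω, S (fun i j => B ω i j) = B ω := by
    intro ω
    ext i j
    simp only [S, Matrix.of_apply]
    have : B ω j i = B ω i j := by
      simpa using (hBh ω).apply i j
    linarith
  have e : (fun ω => cfc f (B ω) k l) = (fun M => cfc f (S M) k l) ∘ (fun ω i j => B ω i j) := by
    funext ω
    simp only [Function.comp]
    rw [hSB]
  rw [e]
  exact this

theorem meas_mul (x : Ω → Matrix n n ℝ) (hx : ∀ i j, Measurable fun ω => x ω i j) (i j : n) :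
    Measurable fun ω => (x ω * x ω) i j := by
  simp only [mul_apply]
  exact Finset.measurable_sum _ fun l _ => (hx i l).mul (hx l j)

theorem psd_sq {x : Matrix n n ℝ} (hx : x.IsHermitian) : (x * x).PosSemidef := by
  have := Matrix.posSemidef_conjTranspose_mul_self x
  rwa [hx.eq] at this

theorem psd_int (x : Ω → Matrix n n ℝ) (hx : ∀ ω, (x ω).PosSemidef) (hi : ∀ i j, Integrable (fun ω => x ω i j) μ) :
    (matIntegral μ x).PosSemidef := by
  refine Matrix.PosSemidef.of_dotProduct_mulVec_nonneg ?_ ?_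
  · ext i j
    simp only [matIntegral, conjTranspose_apply, Matrix.of_apply, star_trivial]
    congr 1; ext ω
    simpa using (hx ω).1.apply i j
  · intro v
    have h : star v ⬝ᵥ matIntegral μ x *ᵥ v = ∫ ω, star v ⬝ᵥ x ω *ᵥ v ∂μ := by
      simp only [dotProduct, mulVec, matIntegral, Matrix.of_apply]
      rw [integral_finsetSum _ fun i _ => (integrable_finsetSum _ fun j _ => (hi i j).mul_const _).const_mul _]
      refine Finset.sum_congr rfl fun i _ => ?_
      rw [integral_const_mul, integral_finsetSum _ fun j _ => (hi i j).mul_const _]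
      congr 1
      refine Finset.sum_congr rfl fun j _ => ?_
      rw [integral_mul_const]
    rw [h]
    exact integral_nonneg fun ω => (hx ω).dotProduct_mulVec_nonneg v

theorem pw_cont (r : ℝ) (hr : 0 ≤ r) : Continuous fun x : ℝ => |x| ^ r :=
  continuous_abs.rpow_const fun _ => Or.inr hr

theorem perk [IsProbabilityMeasure μ] (q : ℝ) (hq : 2 ≤ q) (x A B : Ω → Matrix n n ℝ) (Z : Ω → ℝ)
    (hAB : ∀ ω, A ω - B ω = x ω) (hx : ∀ ω, (x ω).IsHermitian) (hA : ∀ ω, (A ω).IsHermitian) (hB : ∀ ω, (B ω).IsHermitian)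
    (mx : ∀ i j, Measurable fun ω => x ω i j) (mA : ∀ i j, Measurable fun ω => A ω i j) (mB : ∀ i j, Measurable fun ω => B ω i j)
    (hZ1 : ∀ ω, 1 ≤ Z ω) (hZ : Integrable (fun ω => Z ω ^ (q+2)) μ)
    (zx : ∀ ω, eN (x ω) ≤ Z ω) (zA : ∀ ω, eN (A ω) ≤ Z ω) (zB : ∀ ω, eN (B ω) ≤ Z ω)
    (hmean : ∀ i j, ∫ ω, x ω i j ∂μ = 0) (hind : IndepFun (fun ω i j => x ω i j) (fun ω i j => B ω i j) μ) :
    (matIntegral μ fun ω => x ω * x ω).PosSemidef ∧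
    Integrable (fun ω => (x ω * hw q (A ω)).trace) μ ∧
    Integrable (fun ω => ((matIntegral μ fun ω => x ω * x ω) * pw q (A ω)).trace) μ ∧
    Integrable (fun ω => (pw (q+2) (A ω)).trace) μ ∧
    ∫ ω, (x ω * hw q (A ω)).trace ∂μ ≤ (q+1) * (6 * ∫ ω, ((matIntegral μ fun ω => x ω * x ω) * pw q (A ω)).trace ∂μ
      + 8 * (q^2 * (2*q)^(q-2)) * ∫ ω, (pw (q+2) (x ω)).trace ∂μ) := by
  set P := matIntegral μ fun ω => x ω * x ω with hPdef
  have mxx := meas_mul x mx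
  have bx : ∀ ω i j, |x ω i j| ≤ 1 * Z ω ^ (1:ℝ) := by
    intro ω i j
    rw [Real.rpow_one, one_mul]
    exact (entry_le_eN _ i j).trans (zx ω)
  have bxx : ∀ ω i j, |(x ω * x ω) i j| ≤ Fintype.card n * Z ω ^ (2:ℝ) := by
    intro ω i j
    rw [mul_apply]
    refine (Finset.abs_sum_le_sum_abs _ _).trans ?_
    have : ∑ l, |x ω i l * x ω l j| ≤ ∑ l : n, Z ω ^ (2:ℝ) := by
      refine Finset.sum_le_sum fun l _ => ?_
      rw [abs_mul, show Z ω ^ (2:ℝ) = Z ω * Z ω by rw [Real.rpow_two, sq]]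
      exact mul_le_mul ((entry_le_eN _ i l).trans (zx ω)) ((entry_le_eN _ l j).trans (zx ω)) (abs_nonneg _) (by linarith [hZ1 ω])
    simpa using this
  have bP : ∀ ω i j, |P i j| ≤ eN P * Z ω ^ (2:ℝ) := by
    intro ω i j
    have h1 := entry_le_eN P i j
    have h2 : 1 ≤ Z ω ^ (2:ℝ) := Real.one_le_rpow (hZ1 ω) (by norm_num)
    nlinarith [eN_nonneg P]
  have b1 : ∀ a : ℝ, 0 ≤ a → ∀ ω, ∀ i j : n, |(Matrix.of fun _ _ : n => (1:ℝ)) i j| ≤ 1 * Z ω ^ a := by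
    intro a ha ω i j
    have h2 : 1 ≤ Z ω ^ a := Real.one_le_rpow (hZ1 ω) ha
    simpa using h2
  have b1' : ∀ ω, ∀ i j : n, |(1 : Matrix n n ℝ) i j| ≤ 1 * Z ω ^ (0:ℝ) := by
    intro ω i j
    rw [Real.rpow_zero, one_apply]
    split_ifs <;> simp
  have cq := pw_cont q (by linarith)
  have cq2 := pw_cont (q+2) (by linarith)
  have ch : Continuous fun x : ℝ => x * |x| ^ q := continuous_id.mul cq
  have fq : ∀ r : ℝ, ∀ x : ℝ, |(|x| ^ r)| ≤ |x| ^ r := fun r x => by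
    rw [abs_of_nonneg (by positivity)]
  have fh : ∀ x : ℝ, |x * |x| ^ q| ≤ |x| ^ (q+1) := fun x => by
    rw [Real.rpow_add_one' (abs_nonneg _) (by linarith), abs_mul, abs_of_nonneg (by positivity : 0 ≤ |x|^q), mul_comm]
  have hZa : Integrable (fun ω => Z ω ^ (1 + (q+1))) μ := by convert hZ using 3; ring
  have hZb : Integrable (fun ω => Z ω ^ (2 + q)) μ := by convert hZ using 3; ring
  have hZc : Integrable (fun ω => Z ω ^ (0 + (q+2))) μ := by convert hZ using 3; ring
  have hZd : Integrable (fun ω => Z ω ^ (q + 2)) μ := hZ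
  have mP : ∀ i j, Measurable fun _ : Ω => P i j := fun i j => measurable_const
  -- integrability
  have i_xhA : Integrable (fun ω => (x ω * hw q (A ω)).trace) μ :=
    integ_tr x A Z 1 (q+1) 1 (by linarith) _ ch fh hZ1 hZa mx mA hA zA bx
  have i_xhB : Integrable (fun ω => (x ω * hw q (B ω)).trace) μ :=
    integ_tr x B Z 1 (q+1) 1 (by linarith) _ ch fh hZ1 hZa mx mB hB zB bx
  have i_a : Integrable (fun ω => (x ω * x ω * pw q (A ω)).trace) μ :=
    integ_tr (fun ω => x ω * x ω) A Z 2 q _ (by linarith) _ cq (fq q) hZ1 hZb mxx mA hA zA bxx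
  have i_b : Integrable (fun ω => (x ω * x ω * pw q (B ω)).trace) μ :=
    integ_tr (fun ω => x ω * x ω) B Z 2 q _ (by linarith) _ cq (fq q) hZ1 hZb mxx mB hB zB bxx
  have i_a' : Integrable (fun ω => (P * pw q (A ω)).trace) μ :=
    integ_tr (fun ω => P) A Z 2 q _ (by linarith) _ cq (fq q) hZ1 hZb mP mA hA zA bP
  have i_b' : Integrable (fun ω => (P * pw q (B ω)).trace) μ :=
    integ_tr (fun ω => P) B Z 2 q _ (by linarith) _ cq (fq q) hZ1 hZb mP mB hB zB bP
  have i_A : Integrable (fun ω => (pw (q+2) (A ω)).trace) μ := by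
    have := integ_tr (μ := μ) (fun ω => 1) A Z 0 (q+2) _ (by linarith) _ cq2 (fq (q+2)) hZ1 hZc (fun i j => measurable_const) mA hA zA b1'
    simp only [one_mul] at this
    exact this
  have i_m : Integrable (fun ω => (pw (q+2) (x ω)).trace) μ := by
    have := integ_tr (μ := μ) (fun ω => 1) x Z 0 (q+2) _ (by linarith) _ cq2 (fq (q+2)) hZ1 hZc (fun i j => measurable_const) mx hx zx b1'
    simp only [one_mul] at this
    exact this
  have i_xx : ∀ i j, Integrable (fun ω => (x ω * x ω) i j) μ := by
    intro i j
    have hh := integ_entry (μ := μ) (fun ω => Matrix.of fun _ _ : n => (1:ℝ)) x Z q 2 1 (by norm_num) (fun y => y^2) (by fun_prop)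
      (fun y => by simp) hZ1 hZd (fun i j => measurable_const) mx hx zx (b1 q (by linarith)) i j i j
    simp only [cfc_sq' (hx _)] at hh
    simpa using hh
  have hP : P.PosSemidef := psd_int _ (fun ω => psd_sq (hx ω)) i_xx
  refine ⟨hP, i_xhA, i_a', i_A, ?_⟩
  -- independence
  have e_h : ∫ ω, (x ω * hw q (B ω)).trace ∂μ = 0 := by
    rw [indep_tr x (fun ω => hw q (B ω)) mx (meas_cfc B hB mB _ ch)
      (fun i j k l => indep_cfc x B hB hind (fun M => M i j) (by fun_prop) _ ch k l)
      (fun i j => integ_entry x B Z 1 (q+1) 1 (by linarith) _ ch fh hZ1 hZa mx mB hB zB bx i j j i)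
      (fun i j => by
        have hh := integ_entry (μ := μ) (fun ω => Matrix.of fun _ _ : n => (1:ℝ)) B Z 1 (q+1) 1 (by linarith) _ ch fh hZ1 hZa (fun i j => measurable_const) mB hB zB (b1 1 (by norm_num)) i j i j
        simpa [hw] using hh)]
    have : matIntegral μ x = 0 := by
      ext i j; simp [matIntegral, hmean]
    simp [this]
  have e_b : ∫ ω, (x ω * x ω * pw q (B ω)).trace ∂μ = ∫ ω, (P * pw q (B ω)).trace ∂μ := by
    refine indep_tr (fun ω => x ω * x ω) (fun ω => pw q (B ω)) mxx (meas_cfc B hB mB _ cq)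
      (fun i j k l => ?_)
      (fun i j => integ_entry (fun ω => x ω * x ω) B Z 2 q _ (by linarith) _ cq (fq q) hZ1 hZb mxx mB hB zB bxx i j j i)
      (fun i j => by
        have hh := integ_entry (μ := μ) (fun ω => Matrix.of fun _ _ : n => (1:ℝ)) B Z 2 q 1 (by linarith) _ cq (fq q) hZ1 hZb (fun i j => measurable_const) mB hB zB (b1 2 (by norm_num)) i j i j
        simpa [pw] using hh)
    have := indep_cfc x B hB hind (fun M => ∑ l, M i l * M l j) (by fun_prop) _ cq k l
    simp only [mul_apply]
    exact this
  -- Jensen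
  have hT : (pw ((q+2)/2) P).trace ≤ ∫ ω, (pw (q+2) (x ω)).trace ∂μ := by
    have i_t : Integrable (fun ω => (pw (q/2) P * (x ω * x ω)).trace) μ := by
      simp only [trace, diag_apply, mul_apply (M := pw (q/2) P)]
      exact integrable_finsetSum _ fun i _ => integrable_finsetSum _ fun j _ => (i_xx j i).const_mul _
    have e_t : ∫ ω, (pw (q/2) P * (x ω * x ω)).trace ∂μ = (pw ((q+2)/2) P).trace := by
      rw [← pw_mul_self hP q hq]
      have hint : ∀ i j, Integrable (fun ω => pw (q/2) P i j * (x ω * x ω) j i) μ := fun i j => (i_xx j i).const_mul _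
      simp only [trace, diag_apply, mul_apply (M := pw (q/2) P)]
      rw [integral_finsetSum _ fun i _ => integrable_finsetSum _ fun j _ => hint i j]
      refine Finset.sum_congr rfl fun i _ => ?_
      rw [integral_finsetSum _ fun j _ => hint i j]
      refine Finset.sum_congr rfl fun j _ => ?_
      rw [integral_const_mul]
      rfl
    have h := int_comb (μ := μ) _ _ _ _ _ (-1) (2/(q+2)) 0 0 0 (q/(q+2) * (pw ((q+2)/2) P).trace) i_t i_m i_m i_m i_m (fun ω => by
      have := mat5 q hq hP (psd_sq (hx ω))
      rw [pw_sq (hx ω)] at this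
      linarith)
    rw [e_t] at h
    have h1 : q/(q+2) = 1 - 2/(q+2) := by field_simp; ring
    have h2 : 0 < 2/(q+2) := by positivity
    rw [h1] at h
    by_contra hc
    push Not at hc
    nlinarith
  have h0 := int_comb (μ := μ) _ _ _ _ _ (-1) 1 (q+1) (q+1) 0 0 i_xhA i_xhB i_a i_b i_m (fun ω => by
    have := mat0 q hq (hA ω) (hB ω)
    rw [hAB] at this
    linarith)
  have h1 := int_comb (μ := μ) _ _ _ _ _ (-1+1/8+1/8) (1+1/8+1/8) (q^2 * (2*q)^(q-2)) 0 0 0 i_a i_b i_m i_m i_m (fun ω => by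
    have := (le_abs_self _).trans (mat3 q hq (hA ω) (hB ω) (psd_sq (hx ω)))
    rw [hAB, pw_sq (hx ω)] at this
    linarith)
  have h2 := int_comb (μ := μ) _ _ _ _ _ (1/8) (1/8) (-1+1/8) (1+1/8) 0 (q^2 * (2*q)^(q-2) * (pw ((q+2)/2) P).trace) i_a i_b i_b' i_a' i_m (fun ω => by
    have := (neg_le_abs _).trans (mat3 q hq (hA ω) (hB ω) hP)
    rw [hAB] at this
    linarith)
  rw [e_h] at h0
  rw [e_b] at h0 h1 h2
  have hL : 0 ≤ q^2 * (2*q)^(q-2) := by positivity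
  have h3 := mul_le_mul_of_nonneg_left hT hL
  have hm0 : 0 ≤ ∫ ω, (pw (q+2) (x ω)).trace ∂μ := integral_nonneg fun ω => by
    unfold pw; rw [tr_cfc (hx ω)]; exact Finset.sum_nonneg fun i _ => by positivity
  have h3' := mul_nonneg hL hm0
  have ha'0 : 0 ≤ ∫ ω, (P * pw q (A ω)).trace ∂μ := integral_nonneg fun ω => by
    obtain ⟨c, hc, h⟩ := sp_joint hP.1 (hA ω)
    have e2 := h (fun x => x) (fun x => |x|^q)
    rw [sp_cfc_id hP.1] at e2
    show 0 ≤ (P * cfc (fun x : ℝ => |x|^q) (A ω)).trace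
    rw [e2]
    exact Finset.sum_nonneg fun i _ => Finset.sum_nonneg fun j _ =>
      mul_nonneg (mul_nonneg (hP.eigenvalues_nonneg i) (by positivity)) (hc i j)
  generalize (∫ ω, (x ω * x ω * pw q (A ω)).trace ∂μ) = a at *
  generalize (∫ ω, (P * pw q (A ω)).trace ∂μ) = a' at *
  generalize (∫ ω, (P * pw q (B ω)).trace ∂μ) = b at *
  generalize (∫ ω, (pw (q+2) (x ω)).trace ∂μ) = m at *
  generalize (pw ((q+2)/2) P).trace = T at *
  generalize (q^2 * (2*q)^(q-2)) = L at *
  have h4 : a + b ≤ 6 * a' + 8 * L * m := by linarith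
  have h5 := mul_le_mul_of_nonneg_left h4 (by linarith : 0 ≤ q+1)
  linarith
end herm


section herm2
variable {n : Type*} [Fintype n] [DecidableEq n]
variable {Ω : Type*} [MeasurableSpace Ω] {μ : Measure Ω}

theorem eN_add_le (A B : Matrix n n ℝ) : eN (A + B) ≤ eN A + eN B := by
  unfold eN
  simp only [← Finset.sum_add_distrib]
  exact Finset.sum_le_sum fun i _ => Finset.sum_le_sum fun j _ => abs_add_le _ _

theorem eN_sum_le {ι : Type*} (s : Finset ι) (f : ι → Matrix n n ℝ) : eN (∑ k ∈ s, f k) ≤ ∑ k ∈ s, eN (f k) := by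
  classical
  induction s using Finset.induction_on with
  | empty => simp [eN]
  | insert a s ha ih =>
    rw [Finset.sum_insert ha, Finset.sum_insert ha]
    linarith [eN_add_le (f a) (∑ k ∈ s, f k)]

theorem herm_sum {ι : Type*} (s : Finset ι) (f : ι → Matrix n n ℝ) (h : ∀ k, (f k).IsHermitian) : (∑ k ∈ s, f k).IsHermitian := by
  unfold Matrix.IsHermitian
  rw [conjTranspose_sum]
  exact Finset.sum_congr rfl fun k _ => h k

theorem psd_sum {ι : Type*} (s : Finset ι) (f : ι → Matrix n n ℝ) (h : ∀ k, (f k).PosSemidef) : (∑ k ∈ s, f k).PosSemidef := by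
  classical
  induction s using Finset.induction_on with
  | empty => simpa using Matrix.PosSemidef.zero
  | insert a s ha ih =>
    rw [Finset.sum_insert ha]
    exact (h a).add ih

theorem trace_pw_nonneg {A : Matrix n n ℝ} (hA : A.IsHermitian) (r : ℝ) : 0 ≤ (pw r A).trace := by
  unfold pw; rw [tr_cfc hA]; exact Finset.sum_nonneg fun i _ => by positivity

theorem herm_rosenthal [IsProbabilityMeasure μ] {ι : Type*} [Fintype ι] [DecidableEq ι] (q : ℝ) (hq : 2 ≤ q)
    (X : ι → Ω → Matrix n n ℝ) (hX : ∀ k ω, (X k ω).IsHermitian) (mX : ∀ k i j, Measurable fun ω => X k ω i j)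
    (hmean : ∀ k i j, ∫ ω, X k ω i j ∂μ = 0)
    (hind : ∀ k, IndepFun (fun ω i j => X k ω i j) (fun ω i j => (∑ l ∈ Finset.univ.erase k, X l ω) i j) μ)
    (hmom : ∀ k, Integrable (fun ω => (pw (q+2) (X k ω)).trace) μ) :
    (∑ k, matIntegral μ fun ω => X k ω * X k ω).PosSemidef ∧ ∫ ω, (pw (q+2) (∑ k, X k ω)).trace ∂μ ≤
      (12*(q+1))^((q+2)/2) * (pw ((q+2)/2) (∑ k, matIntegral μ fun ω => X k ω * X k ω)).trace
      + 16 * (q+1) * (q^2 * (2*q)^(q-2)) * ∑ k, ∫ ω, (pw (q+2) (X k ω)).trace ∂μ := by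
  rcases isEmpty_or_nonempty ι with he | ⟨⟨k0⟩⟩
  · have h0 : (0 : Matrix n n ℝ).IsHermitian := Matrix.isHermitian_zero
    have : pw (q+2) (0 : Matrix n n ℝ) = 0 := by rw [← mul_hw h0 q hq, zero_mul]
    simp only [Finset.univ_eq_empty, Finset.sum_empty, this, trace_zero, integral_zero, mul_zero, add_zero]
    exact ⟨Matrix.PosSemidef.zero, mul_nonneg (by positivity) (trace_pw_nonneg h0 _)⟩
  have hp : 0 < q + 2 := by linarith
  let Z : Ω → ℝ := fun ω => 1 + ∑ k, eN (X k ω)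
  have hZ1 : ∀ ω, 1 ≤ Z ω := fun ω => by
    have : 0 ≤ ∑ k, eN (X k ω) := Finset.sum_nonneg fun k _ => eN_nonneg _
    simp only [Z]; linarith
  have hent : ∀ k i j, MemLp (fun ω => |X k ω i j|) (ENNReal.ofReal (q+2)) μ := by
    intro k i j
    have hm : AEStronglyMeasurable (fun ω => |X k ω i j|) μ := (mX k i j).abs.aestronglyMeasurable
    rw [← integrable_norm_rpow_iff hm (by simp [hp]) ENNReal.ofReal_ne_top, ENNReal.toReal_ofReal hp.le]
    refine ((hmom k).const_mul ((Fintype.card n : ℝ)^(q+2))).mono' (by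
      exact ((mX k i j).abs.norm.pow_const _).aestronglyMeasurable) (Filter.Eventually.of_forall fun ω => ?_)
    have := entry_pow_le (hX k ω) (q+2) hp i j
    rw [Real.norm_of_nonneg (by positivity), Real.norm_eq_abs, abs_abs]
    exact this
  have hZL : MemLp Z (ENNReal.ofReal (q+2)) μ := by
    have h : MemLp (fun ω => ∑ k, eN (X k ω)) (ENNReal.ofReal (q+2)) μ := by
      simp only [eN]
      exact memLp_finset_sum _ fun k _ => memLp_finset_sum _ fun i _ => memLp_finset_sum _ fun j _ => hent k i j
    have h1 : MemLp (fun _ : Ω => (1:ℝ)) (ENNReal.ofReal (q+2)) μ := memLp_const 1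
    exact h1.add h
  have hZ : Integrable (fun ω => Z ω ^ (q+2)) μ := by
    have := hZL.integrable_norm_rpow (by simp [hp]) ENNReal.ofReal_ne_top
    rw [ENNReal.toReal_ofReal hp.le] at this
    refine this.congr (Filter.Eventually.of_forall fun ω => ?_)
    simp only [Real.norm_of_nonneg (by linarith [hZ1 ω] : 0 ≤ Z ω)]
  have zs : ∀ (s : Finset ι) ω, eN (∑ k ∈ s, X k ω) ≤ Z ω := fun s ω => by
    have h1 := eN_sum_le s (fun k => X k ω)
    have h2 : ∑ k ∈ s, eN (X k ω) ≤ ∑ k, eN (X k ω) :=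
      Finset.sum_le_sum_of_subset_of_nonneg (Finset.subset_univ s) fun k _ _ => eN_nonneg _
    simp only [Z]; linarith
  have ms : ∀ (s : Finset ι) i j, Measurable fun ω => (∑ k ∈ s, X k ω) i j := fun s i j => by
    simp only [Matrix.sum_apply]
    exact Finset.measurable_sum _ fun k _ => mX k i j
  have main := fun k => perk (μ := μ) q hq (X k) (fun ω => ∑ l, X l ω) (fun ω => ∑ l ∈ Finset.univ.erase k, X l ω) Z
    (fun ω => by rw [← Finset.add_sum_erase _ _ (Finset.mem_univ k)]; simp) (hX k)
    (fun ω => herm_sum _ _ fun k => hX k ω) (fun ω => herm_sum _ _ fun k => hX k ω) (mX k) (ms _) (ms _) hZ1 hZ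
    (fun ω => by have := zs {k} ω; simpa using this) (zs _) (zs _) (hmean k) (hind k)
  have hA : ∀ ω, (∑ k, X k ω).IsHermitian := fun ω => herm_sum _ _ fun k => hX k ω
  set Pk : ι → Matrix n n ℝ := fun k => matIntegral μ fun ω => X k ω * X k ω with hPk
  have hS : (∑ k, Pk k).PosSemidef := psd_sum _ _ fun k => (main k).1
  have iA := (main k0).2.2.2.1
  have e1 : ∫ ω, (pw (q+2) (∑ k, X k ω)).trace ∂μ = ∑ k, ∫ ω, (X k ω * hw q (∑ l, X l ω)).trace ∂μ := by
    rw [← integral_finsetSum _ fun k _ => (main k).2.1]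
    congr 1; ext ω
    rw [← mul_hw (hA ω) q hq, Finset.sum_mul, trace_sum]
  have e2 : ∫ ω, ((∑ k, Pk k) * pw q (∑ k, X k ω)).trace ∂μ = ∑ k, ∫ ω, (Pk k * pw q (∑ l, X l ω)).trace ∂μ := by
    rw [← integral_finsetSum _ fun k _ => (main k).2.2.1]
    congr 1; ext ω
    rw [Finset.sum_mul, trace_sum]
  have i2 : Integrable (fun ω => ((∑ k, Pk k) * pw q (∑ k, X k ω)).trace) μ := by
    have := integrable_finsetSum (μ := μ) Finset.univ fun k _ => (main k).2.2.1
    refine this.congr (Filter.Eventually.of_forall fun ω => ?_)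
    simp only [Finset.sum_mul, trace_sum]; rfl
  have h1 : ∫ ω, (pw (q+2) (∑ k, X k ω)).trace ∂μ ≤ 6 * (q+1) * ∫ ω, ((∑ k, Pk k) * pw q (∑ k, X k ω)).trace ∂μ
      + 8 * (q+1) * (q^2 * (2*q)^(q-2)) * ∑ k, ∫ ω, (pw (q+2) (X k ω)).trace ∂μ := by
    rw [e1, e2, Finset.mul_sum, Finset.mul_sum, ← Finset.sum_add_distrib]
    refine Finset.sum_le_sum fun k _ => ((main k).2.2.2.2).trans (le_of_eq ?_)
    ring
  have h2 := int_comb (μ := μ) _ _ _ _ _ (-(6*(q+1))) (1/2) 0 0 0 (1/2 * (12*(q+1))^((q+2)/2) * (pw ((q+2)/2) (∑ k, Pk k)).trace) i2 iA iA iA iA (fun ω => by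
    have := mat4 q (6*(q+1)) hq (by linarith) hS (hA ω)
    rw [show 2 * (6*(q+1)) = 12*(q+1) by ring] at this
    linarith)
  refine ⟨hS, ?_⟩
  linarith
end herm2


section dil
variable {n : Type*} [Fintype n] [DecidableEq n]
variable {d₁ d₂ : Type*} [Fintype d₁] [Fintype d₂] [DecidableEq d₁] [DecidableEq d₂]

theorem sum_eig_roots {A : Matrix n n ℝ} (hA : A.IsHermitian) (f : ℝ → ℝ) :
    ∑ i, f (hA.eigenvalues i) = (A.charpoly.roots.map f).sum := by
  rw [hA.roots_charpoly_eq_eigenvalues, Multiset.map_map]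
  rfl

theorem tr_pw_roots {A : Matrix n n ℝ} (hA : A.IsHermitian) (r : ℝ) :
    (pw r A).trace = (A.charpoly.roots.map (fun x => |x|^r)).sum := by
  unfold pw
  rw [tr_cfc hA, sum_eig_roots hA (fun x => |x|^r)]

theorem schattenPow_eq_s2 (r : ℝ) (Y : Matrix d₁ d₂ ℝ) : schattenPow r Y = (pw r (Yᵀ * Y)).trace := by
  have h := Matrix.isHermitian_conjTranspose_mul_self Y
  have e : Yᵀ * Y = Yᴴ * Y := by rw [conjTranspose_eq_transpose_of_trivial]
  rw [e]
  unfold schattenPow pw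
  rw [tr_cfc h]
  refine Finset.sum_congr rfl fun i _ => ?_
  rw [abs_of_nonneg ((Matrix.posSemidef_conjTranspose_mul_self Y).eigenvalues_nonneg i)]

theorem tr_pw_comm (r : ℝ) (hr : 0 < r) (Y : Matrix d₁ d₂ ℝ) : (pw r (Y * Yᵀ)).trace = (pw r (Yᵀ * Y)).trace := by
  have h1 : (Y * Yᵀ).IsHermitian := by
    rw [← conjTranspose_eq_transpose_of_trivial]; exact Matrix.isHermitian_mul_conjTranspose_self Y
  have h2 : (Yᵀ * Y).IsHermitian := by
    rw [← conjTranspose_eq_transpose_of_trivial]; exact Matrix.isHermitian_conjTranspose_mul_self Y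
  rw [tr_pw_roots h1, tr_pw_roots h2]
  have h := congrArg Polynomial.roots (Matrix.charpoly_mul_comm' Y Yᵀ)
  rw [Polynomial.roots_mul (mul_ne_zero (pow_ne_zero _ Polynomial.X_ne_zero) (Matrix.charpoly_monic _).ne_zero),
    Polynomial.roots_mul (mul_ne_zero (pow_ne_zero _ Polynomial.X_ne_zero) (Matrix.charpoly_monic _).ne_zero)] at h
  have h' := congrArg (fun s => (Multiset.map (fun x : ℝ => |x|^r) s).sum) h
  simpa [Real.zero_rpow hr.ne', Multiset.map_nsmul, Multiset.sum_nsmul] using h'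

theorem tr_pw_block (r : ℝ) {P : Matrix d₁ d₁ ℝ} {Q : Matrix d₂ d₂ ℝ} (hP : P.IsHermitian) (hQ : Q.IsHermitian) :
    (pw r (fromBlocks P 0 0 Q)).trace = (pw r P).trace + (pw r Q).trace := by
  have h : (fromBlocks P 0 0 Q).IsHermitian := Matrix.IsHermitian.fromBlocks hP (by simp) hQ
  rw [tr_pw_roots h, tr_pw_roots hP, tr_pw_roots hQ, charpoly_fromBlocks_zero₁₂,
    Polynomial.roots_mul (mul_ne_zero (Matrix.charpoly_monic _).ne_zero (Matrix.charpoly_monic _).ne_zero)]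
  simp

/-- dilation -/
def dil (Y : Matrix d₁ d₂ ℝ) : Matrix (d₁ ⊕ d₂) (d₁ ⊕ d₂) ℝ := fromBlocks 0 Y Yᵀ 0

theorem dil_herm (Y : Matrix d₁ d₂ ℝ) : (dil Y).IsHermitian :=
  Matrix.IsHermitian.fromBlocks (by simp) (by simp) (by simp)

theorem dil_sq (Y : Matrix d₁ d₂ ℝ) : dil Y * dil Y = fromBlocks (Y * Yᵀ) 0 0 (Yᵀ * Y) := by
  simp [dil, fromBlocks_multiply]

theorem tr_pw_dil (r : ℝ) (hr : 0 < r) (Y : Matrix d₁ d₂ ℝ) : (pw r (dil Y)).trace = 2 * schattenPow (r/2) Y := by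
  have h1 : (Y * Yᵀ).IsHermitian := by
    rw [← conjTranspose_eq_transpose_of_trivial]; exact Matrix.isHermitian_mul_conjTranspose_self Y
  have h2 : (Yᵀ * Y).IsHermitian := by
    rw [← conjTranspose_eq_transpose_of_trivial]; exact Matrix.isHermitian_conjTranspose_mul_self Y
  rw [← pw_sq (dil_herm Y), dil_sq, tr_pw_block _ h1 h2, tr_pw_comm _ (by linarith), schattenPow_eq_s2]
  ring

theorem schatten_sqrt (r : ℝ) {P : Matrix n n ℝ} (hP : P.PosSemidef) : schattenPow r (psdSqrt P) = (pw r P).trace := by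
  rw [schattenPow_eq_s2]
  congr 2
  unfold psdSqrt
  rw [dif_pos hP]
  unfold Matrix.PosSemidef.sqrt
  have hs := hP.1.spectral_theorem
  have hU := Unitary.coe_star_mul_self hP.1.eigenvectorUnitary
  conv_rhs => rw [hs]
  rw [Unitary.conjStarAlgAut_apply]
  rw [star_eq_conjTranspose, conjTranspose_eq_transpose_of_trivial] at hU ⊢
  set U : Matrix n n ℝ := hP.1.eigenvectorUnitary.1 with hUdef
  have hD : diagonal ((fun x : ℝ => Real.sqrt x) ∘ hP.1.eigenvalues) * diagonal ((fun x : ℝ => Real.sqrt x) ∘ hP.1.eigenvalues)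
     = diagonal (RCLike.ofReal ∘ hP.1.eigenvalues) := by
    rw [diagonal_mul_diagonal]
    congr 1; ext i
    simp [Real.mul_self_sqrt (hP.eigenvalues_nonneg i)]
  rw [transpose_mul, transpose_mul, transpose_transpose, diagonal_transpose, ← hD]
  generalize diagonal ((fun x : ℝ => Real.sqrt x) ∘ hP.1.eigenvalues) = D
  calc _ = U * (D * (Uᵀ * U) * D) * Uᵀ := by simp only [mul_assoc]
    _ = _ := by rw [hU, mul_one]

theorem const1 (t : ℝ) (ht : 1 ≤ t) : (12*(4*t-2+1))^(2*t) ≤ 2 * (16*t)^(3*t) := by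
  have h1 : (16*t)^(3*t) = ((16*t)^(3/2:ℝ))^(2*t) := by
    rw [← Real.rpow_mul (by linarith)]; congr 1; ring
  have h2 : 12*(4*t-2+1) ≤ (16*t)^(3/2:ℝ) := by
    rw [show (3/2:ℝ) = 1 + 1/2 by norm_num, Real.rpow_add (by linarith), Real.rpow_one]
    have h3 : 4 ≤ (16*t)^(1/2:ℝ) := by
      rw [← Real.sqrt_eq_rpow]
      exact Real.le_sqrt_of_sq_le (by linarith)
    nlinarith
  have h4 : (12*(4*t-2+1))^(2*t) ≤ ((16*t)^(3/2:ℝ))^(2*t) := Real.rpow_le_rpow (by linarith) h2 (by linarith)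
  have h5 : 0 ≤ ((16*t)^(3/2:ℝ))^(2*t) := by positivity
  rw [h1]; linarith

theorem const2 (t : ℝ) (ht : 1 ≤ t) (q : ℝ) (hq : q = 4*t-2) : 16*(q+1)*(q^2 * (2*q)^(q-2)) ≤ (8*t)^(4*t) := by
  have hq2 : 2 ≤ q := by linarith
  rw [show 8*t = 2*q+4 by linarith, show 4*t = q + 2 by linarith, Real.rpow_add (by linarith)]
  have h1 : q^2 * (2*q)^(q-2) = (2*q)^q / 4 := by
    rw [Real.rpow_sub (by linarith), Real.rpow_two]
    field_simp; norm_num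
  rw [h1, Real.rpow_two]
  have h2 : (2*q)^q ≤ (2*q+4)^q := Real.rpow_le_rpow (by linarith) (by linarith) (by linarith)
  have h3 : 0 ≤ (2*q)^q := by positivity
  calc _ = (2*q)^q * (4*(q+1)) := by ring
    _ ≤ (2*q+4)^q * (2*q+4)^2 := mul_le_mul h2 (by nlinarith) (by linarith) (by positivity)

end dil

theorem final_rosenthal
    {Ω : Type*} [MeasurableSpace Ω] (μ : Measure Ω) [IsProbabilityMeasure μ]
    {ι : Type*} [Fintype ι]
    {d₁ d₂ : Type*} [Fintype d₁] [Fintype d₂] [DecidableEq d₁] [DecidableEq d₂]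
    (t : ℝ) (ht : 1 ≤ t)
    (Y : ι → Ω → Matrix d₁ d₂ ℝ)
    (hmeas : ∀ k i j, Measurable fun ω => Y k ω i j)
    (hindep : iIndepFun (fun k ω i j => Y k ω i j) μ)
    (hmean : ∀ k i j, ∫ ω, Y k ω i j ∂μ = 0)
    (hmom : ∀ k, Integrable (fun ω => schattenPow (2 * t) (Y k ω)) μ) :
    ∫ ω, schattenPow (2 * t) (∑ k, Y k ω) ∂μ
      ≤ (16 * t) ^ (3 * t) *
          (schattenPow (2 * t) (psdSqrt (∑ k, matIntegral μ fun ω => Y k ω * (Y k ω)ᵀ))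
            + schattenPow (2 * t) (psdSqrt (∑ k, matIntegral μ fun ω => (Y k ω)ᵀ * Y k ω)))
        + (8 * t) ^ (4 * t) * ∑ k, ∫ ω, schattenPow (2 * t) (Y k ω) ∂μ := by
  classical
  obtain ⟨q, hq⟩ : ∃ q, q = 4*t-2 := ⟨_, rfl⟩
  have hq2 : 2 ≤ q := by linarith
  have ep : q + 2 = 4*t := by linarith
  have eh : (q+2)/2 = 2*t := by linarith
  have edil : ∀ M : Matrix d₁ d₂ ℝ, (pw (q+2) (dil M)).trace = 2 * schattenPow (2*t) M := fun M => by
    rw [tr_pw_dil _ (by linarith), eh]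
  have dsum : ∀ (s : Finset ι) (ω), ∑ k ∈ s, dil (Y k ω) = dil (∑ k ∈ s, Y k ω) := by
    intro s ω
    ext (i|i) (j|j) <;> simp [dil, Matrix.sum_apply]
  have mdil : ∀ k i j, Measurable fun ω => dil (Y k ω) i j := by
    rintro k (i|i) (j|j) <;> simp [dil, hmeas]
  have hind : ∀ k, IndepFun (fun ω i j => dil (Y k ω) i j) (fun ω i j => (∑ l ∈ Finset.univ.erase k, dil (Y l ω)) i j) μ := by
    intro k
    have h := (hindep.indepFun_finsetSum_of_notMem (fun k => by
      exact measurable_pi_lambda _ fun i => measurable_pi_lambda _ fun j => hmeas k i j)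
      (Finset.notMem_erase k Finset.univ)).symm
    let φ : (d₁ → d₂ → ℝ) → (d₁ ⊕ d₂ → d₁ ⊕ d₂ → ℝ) := fun M i j => dil (Matrix.of M) i j
    have hφ : Measurable φ := by
      refine measurable_pi_lambda _ fun i => measurable_pi_lambda _ fun j => ?_
      rcases i with i|i <;> rcases j with j|j <;> simp only [φ, dil, fromBlocks_apply₁₁, fromBlocks_apply₁₂, fromBlocks_apply₂₁, fromBlocks_apply₂₂, Matrix.zero_apply, transpose_apply, Matrix.of_apply] <;> fun_prop
    have h2 := h.comp hφ hφ
    have e : (fun ω i j => (∑ l ∈ Finset.univ.erase k, dil (Y l ω)) i j) = φ ∘ (∑ l ∈ Finset.univ.erase k, fun ω i j => Y l ω i j) := by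
      funext ω i j
      rw [dsum]
      simp only [φ, Function.comp]
      congr 2
      ext a b
      simp [Matrix.sum_apply, Finset.sum_apply]
    rw [e]
    exact h2
  obtain ⟨hpsd, key⟩ := herm_rosenthal (μ := μ) q hq2 (fun k ω => dil (Y k ω)) (fun k ω => dil_herm _) mdil
    (by rintro k (i|i) (j|j) <;> simp [dil, hmean]) hind
    (fun k => by simp only [edil]; exact (hmom k).const_mul 2)
  have eP : (∑ k, matIntegral μ fun ω => dil (Y k ω) * dil (Y k ω)) =
      fromBlocks (∑ k, matIntegral μ fun ω => Y k ω * (Y k ω)ᵀ) 0 0 (∑ k, matIntegral μ fun ω => (Y k ω)ᵀ * Y k ω) := by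
    simp only [dil_sq]
    ext (i|i) (j|j) <;> simp [matIntegral, Matrix.sum_apply]
  rw [eP] at hpsd key
  have hP := hpsd.submatrix (Sum.inl : d₁ → d₁ ⊕ d₂)
  have hQ := hpsd.submatrix (Sum.inr : d₂ → d₁ ⊕ d₂)
  have eP1 : ∀ (P : Matrix d₁ d₁ ℝ) (Q : Matrix d₂ d₂ ℝ), (fromBlocks P 0 0 Q).submatrix Sum.inl Sum.inl = P := fun P Q => by
    ext i j; simp
  have eP2 : ∀ (P : Matrix d₁ d₁ ℝ) (Q : Matrix d₂ d₂ ℝ), (fromBlocks P 0 0 Q).submatrix Sum.inr Sum.inr = Q := fun P Q => by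
    ext i j; simp
  rw [eP1] at hP
  rw [eP2] at hQ
  rw [tr_pw_block _ hP.1 hQ.1, eh] at key
  simp only [dsum, edil, integral_const_mul, ← Finset.mul_sum] at key
  rw [schatten_sqrt _ hP, schatten_sqrt _ hQ]
  have c1 := const1 t ht
  have c2 := const2 t ht q hq
  rw [← hq] at c1
  have n1 := add_nonneg (trace_pw_nonneg hP.1 (2*t)) (trace_pw_nonneg hQ.1 (2*t))
  have n2 : 0 ≤ ∑ k, ∫ ω, schattenPow (2 * t) (Y k ω) ∂μ := Finset.sum_nonneg fun k _ => integral_nonneg fun ω => by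
    have h := edil (Y k ω)
    have h' := trace_pw_nonneg (dil_herm (Y k ω)) (q+2)
    simp only [Pi.zero_apply]
    linarith
  have f1 := mul_le_mul_of_nonneg_right c1 n1
  have f2 := mul_le_mul_of_nonneg_right c2 n2
  linarith

/-- **Non-Hermitian matrix Rosenthal inequality** (Lemma 4.1). For `t = 1` or `t ≥ 3/2` and
a finite sequence `{Y k}` of centered, independent random `d₁ × d₂` real matrices with
finite Schatten `4t`-moments,
`E ‖∑ k Y k‖_{4t}^{4t} ≤ (16t)^{3t} (‖(∑ k E[Y k (Y k)ᵀ])^{1/2}‖_{4t}^{4t}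
  + ‖(∑ k E[(Y k)ᵀ (Y k)])^{1/2}‖_{4t}^{4t}) + (8t)^{4t} ∑ k E ‖Y k‖_{4t}^{4t}`. -/
theorem nonhermitian_matrix_rosenthal
    {Ω : Type*} [MeasurableSpace Ω] (μ : Measure Ω) [IsProbabilityMeasure μ]
    {ι : Type*} [Fintype ι]
    {d₁ d₂ : Type*} [Fintype d₁] [Fintype d₂] [DecidableEq d₁] [DecidableEq d₂]
    (t : ℝ) (ht : t = 1 ∨ 3 / 2 ≤ t)
    (Y : ι → Ω → Matrix d₁ d₂ ℝ)
    (hmeas : ∀ k i j, Measurable fun ω => Y k ω i j)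
    (hindep : iIndepFun (fun k ω i j => Y k ω i j) μ)
    (hmean : ∀ k i j, ∫ ω, Y k ω i j ∂μ = 0)
    (hmom : ∀ k, Integrable (fun ω => schattenPow (2 * t) (Y k ω)) μ) :
    ∫ ω, schattenPow (2 * t) (∑ k, Y k ω) ∂μ
      ≤ (16 * t) ^ (3 * t) *
          (schattenPow (2 * t) (psdSqrt (∑ k, matIntegral μ fun ω => Y k ω * (Y k ω)ᵀ))
            + schattenPow (2 * t) (psdSqrt (∑ k, matIntegral μ fun ω => (Y k ω)ᵀ * Y k ω)))
        + (8 * t) ^ (4 * t) * ∑ k, ∫ ω, schattenPow (2 * t) (Y k ω) ∂μ := by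
  exact final_rosenthal μ t (by rcases ht with h | h <;> linarith) Y hmeas hindep hmean hmom
end
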